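/- arXiv:1207.4927 — 3 statements merged into one kernel-verified Lean document; each statement's English description precedes it below -/
import Mathlib

section
/- The Riemann zeta function is not real-valued on any nondegenerate subinterval of the critical line: for all real numbers a < b there exists t ∈ [a,b] such that the imaginary part of ζ(1/2 + it) is nonzero. -/
/-- The Riemann zeta function is not real-valued on any nondegenerate
subinterval of the critical line: for all reals `a < b` there is `t ∈ [a,b]` with
`Im ζ(1/2 + it) ≠ 0`. -/
theorem zeta_not_real_on_critical_interval :
    ∀ a b : ℝ, a < b → ∃ t ∈ Set.Icc a b,
      (riemannZeta (1 / 2 + Complex.I * t)).im ≠ 0 := by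
  intro a b hab
  by_contra! h
  have hsym : ∀ t ∈ Set.Icc a b, riemannZeta (1 / 2 + Complex.I * t) =
      riemannZeta (1 - (1 / 2 + Complex.I * t)) := by
    intro t ht
    have h1 : (1 - (1 / 2 + Complex.I * t) : ℂ) =
        (starRingEnd ℂ) (1 / 2 + Complex.I * t) := by
      apply Complex.ext <;> simp
      norm_num
    rw [h1, riemannZeta_conj]
    exact (Complex.conj_eq_iff_im.mpr (h t ht)).symm
  set U : Set ℂ := ({0, 1} : Set ℂ)ᶜ with hU
  have hcount : ({0, 1} : Set ℂ).Countable := (Set.toFinite _).countable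
  have hconn : IsPreconnected U :=
    (hcount.isConnected_compl_of_one_lt_rank (by simp)).isPreconnected
  have hopen : IsOpen U := (Set.toFinite ({0, 1} : Set ℂ)).isClosed.isOpen_compl
  have hf : AnalyticOnNhd ℂ riemannZeta U := by
    refine DifferentiableOn.analyticOnNhd (fun z hz => ?_) hopen
    refine (differentiableAt_riemannZeta ?_).differentiableWithinAt
    rintro rfl
    simp [hU] at hz
  have hg : AnalyticOnNhd ℂ (fun z => riemannZeta (1 - z)) U := by
    refine DifferentiableOn.analyticOnNhd (fun z hz => ?_) hopen
    have hz1 : (1 - z) ≠ 1 := by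
      intro h0
      have : z = 0 := by linear_combination -h0
      simp [hU, this] at hz
    exact ((differentiableAt_riemannZeta hz1).comp z
      (by fun_prop : DifferentiableAt ℂ (fun z : ℂ => 1 - z) z)).differentiableWithinAt
  have hz0 : (1 / 2 + Complex.I * a : ℂ) ∈ U := by
    simp only [hU, Set.mem_compl_iff, Set.mem_insert_iff, Set.mem_singleton_iff, not_or]
    constructor <;> intro h0 <;> have := congrArg Complex.re h0 <;> norm_num at this
  have htend : Filter.Tendsto (fun t : ℝ => (1 / 2 + Complex.I * t : ℂ))
      (nhdsWithin a (Set.Ioi a)) (nhdsWithin (1 / 2 + Complex.I * a : ℂ) {1 / 2 + Complex.I * a}ᶜ) := by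
    refine tendsto_nhdsWithin_iff.mpr ⟨?_, ?_⟩
    · refine (Continuous.tendsto ?_ a).mono_left nhdsWithin_le_nhds
      fun_prop
    · filter_upwards [self_mem_nhdsWithin] with t ht h0
      have := congrArg Complex.im h0
      simp at this
      exact (ne_of_gt ht) this
  have hfreq : ∃ᶠ z in nhdsWithin (1 / 2 + Complex.I * a : ℂ) {1 / 2 + Complex.I * a}ᶜ,
      riemannZeta z = riemannZeta (1 - z) := by
    refine htend.frequently (Filter.Eventually.frequently ?_)
    filter_upwards [Ioc_mem_nhdsGT hab] with t ht
    exact hsym t ⟨ht.1.le, ht.2⟩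
  have key := hf.eqOn_of_preconnected_of_frequently_eq hg hconn hz0 hfreq
  have h2 : (-2 : ℂ) ∈ U := by
    simp only [hU, Set.mem_compl_iff, Set.mem_insert_iff, Set.mem_singleton_iff, not_or]
    norm_num
  have h3 := key h2
  have h4 := riemannZeta_neg_two_mul_nat_add_one 0
  norm_num at h3 h4
  rw [h4] at h3
  exact riemannZeta_ne_zero_of_one_le_re (s := 3) (by norm_num) h3.symm
end

section
/- (Voronin density theorem.) Let σ satisfy 1/2 < σ ≤ 1 and let n be a positive natural number. Then the set of n-tuples { (ζ(σ+it), ζ'(σ+it), …, ζ^{(n−1)}(σ+it)) : t ∈ ℝ } is dense in ℂⁿ, where ζ^{(k)} denotes the k-th complex derivative of ζ. -/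
open MeasureTheory FourierTransform SchwartzMap in
theorem vor_plancherel (g : ℝ → ℂ) (h1 : Integrable g) (h2 : MemLp g 2) :
    eLpNorm (𝓕 g) 2 volume = eLpNorm g 2 volume := by
  set G : Lp ℂ 2 (volume : Measure ℝ) := h2.toLp g with hG
  have hcont : Continuous (𝓕 g) := by
    exact VectorFourier.fourierIntegral_continuous Real.continuous_fourierChar (by fun_prop) h1
  have hae : ∀ᵐ x : ℝ, (𝓕 g) x = (𝓕 G : Lp ℂ 2 (volume : Measure ℝ)) x := by
    apply ae_eq_of_integral_contDiff_smul_eq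
    · exact hcont.locallyIntegrable
    · exact (Lp.memLp _).locallyIntegrable (by norm_num)
    intro ψ hψ hs
    have hs' : HasCompactSupport (fun x => (ψ x : ℂ)) := hs.comp_left (g := fun x : ℝ => (x:ℂ)) (by simp)
    have hd' : ContDiff ℝ (⊤ : ℕ∞) (fun x => (ψ x : ℂ)) := Complex.ofRealCLM.contDiff.comp hψ
    let φ : 𝓢(ℝ, ℂ) := hs'.toSchwartzMap hd'
    have e := congrArg (fun F => F φ) (Lp.fourier_toTemperedDistribution_eq G)
    simp only [TemperedDistribution.fourier_apply, Lp.toTemperedDistribution_apply] at e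
    have hφ : ∀ x, φ x = (ψ x : ℂ) := fun x => rfl
    simp only [hφ] at e
    have e3 : ∀ x (z : ℂ), (ψ x) • z = (ψ x : ℂ) • z := by intro x z; simp
    simp only [e3]
    rw [← e]
    have e4 : ∫ x, (𝓕 φ) x • G x = ∫ x, (𝓕 φ) x • g x := by
      apply integral_congr_ae
      filter_upwards [h2.coeFn_toLp] with x hx
      rw [← hx]
    rw [e4, SchwartzMap.fourier_coe]
    have := VectorFourier.integral_fourierIntegral_smul_eq_flip (L := innerₗ ℝ) (μ := volume) (ν := volume) Real.continuous_fourierChar (by fun_prop) φ.integrable h1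
    rw [flip_innerₗ] at this
    exact this.symm
  rw [eLpNorm_congr_ae hae, ← eLpNorm_congr_ae h2.coeFn_toLp]
  have := Lp.norm_fourier_eq G
  rw [Lp.norm_def, Lp.norm_def] at this
  exact (ENNReal.toReal_eq_toReal_iff' (Lp.eLpNorm_ne_top _) (Lp.eLpNorm_ne_top _)).1 this

open MeasureTheory FourierTransform in
theorem vor_plancherel_int (g : ℝ → ℂ) (h1 : Integrable g) (h2 : MemLp g 2) :
    Integrable (fun t => ‖𝓕 g t‖ ^ 2) ∧ ∫ t, ‖𝓕 g t‖ ^ 2 = ∫ t, ‖g t‖ ^ 2 := by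
  have hcont : Continuous (𝓕 g) := by
    exact VectorFourier.fourierIntegral_continuous Real.continuous_fourierChar (by fun_prop) h1
  have h := vor_plancherel g h1 h2
  have h3 : MemLp (𝓕 g) 2 := ⟨hcont.aestronglyMeasurable, by rw [h]; exact h2.2⟩
  refine ⟨(memLp_two_iff_integrable_sq_norm h3.1).1 h3, ?_⟩
  have e := h
  rw [h3.eLpNorm_eq_integral_rpow_norm (by norm_num) (by norm_num),
    h2.eLpNorm_eq_integral_rpow_norm (by norm_num) (by norm_num)] at e
  rw [ENNReal.ofReal_eq_ofReal_iff (by positivity) (by positivity)] at e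
  simp only [ENNReal.toReal_ofNat, Real.rpow_two] at e
  have p1 : 0 ≤ ∫ t, ‖𝓕 g t‖ ^ 2 := integral_nonneg (fun _ => by positivity)
  have p2 : 0 ≤ ∫ t, ‖g t‖ ^ 2 := integral_nonneg (fun _ => by positivity)
  have := congrArg (fun x : ℝ => x ^ (2:ℝ)) e
  rw [← Real.rpow_mul p1, ← Real.rpow_mul p2] at this
  simpa using this

open MeasureTheory FourierTransform in
theorem vor_mellin_ms (D : ℝ → ℂ) (hm : Measurable D) (C : ℝ) (hC : ∀ x, ‖D x‖ ≤ C) (N : ℝ)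
    (hN : 1 ≤ N) (σ : ℝ) (hσ : 0 < σ) :
    Integrable (fun t : ℝ => ‖mellin (Set.indicator (Set.Ioi N) D) (-(σ + t * Complex.I))‖ ^ 2) ∧
    ∫ t : ℝ, ‖mellin (Set.indicator (Set.Ioi N) D) (-(σ + t * Complex.I))‖ ^ 2
      ≤ 2 * Real.pi * (C ^ 2 * N ^ (-(2 * σ)) / (2 * σ)) := by
  set f := Set.indicator (Set.Ioi N) D with hf
  set g : ℝ → ℂ := fun u => Real.exp (σ * u) • f (Real.exp (-u)) with hg
  have hC0 : 0 ≤ C := (norm_nonneg _).trans (hC 0)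
  have hfm : Measurable f := hm.indicator measurableSet_Ioi
  have hgm : Measurable g := by
    have a1 : Measurable (fun u : ℝ => Real.exp (σ * u)) := by fun_prop
    have a2 : Measurable (fun u : ℝ => f (Real.exp (-u))) := hfm.comp (by fun_prop)
    exact a1.smul a2
  have hNpos : 0 < N := by linarith
  have hgb : ∀ u, ‖g u‖ ≤ Set.indicator (Set.Iic (-Real.log N)) (fun u => C * Real.exp (σ * u)) u := by
    intro u
    simp only [hg, norm_smul, Real.norm_eq_abs, Real.abs_exp]
    by_cases hu : u ∈ Set.Iic (-Real.log N)
    · rw [Set.indicator_of_mem hu, mul_comm]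
      gcongr
      rw [hf]
      exact (norm_indicator_le_norm_self _ _).trans (hC _)
    · rw [Set.indicator_of_notMem hu]
      have : Real.exp (-u) ∉ Set.Ioi N := by
        simp only [Set.mem_Iic, not_le, Set.mem_Ioi, not_lt] at hu ⊢
        rw [← Real.exp_log hNpos]
        apply Real.exp_le_exp.2; linarith
      rw [hf, Set.indicator_of_notMem this]; simp
  have hgb2 : ∀ u, ‖g u‖ ^ 2 ≤ Set.indicator (Set.Iic (-Real.log N)) (fun u => C ^ 2 * Real.exp ((2 * σ) * u)) u := by
    intro u
    have := hgb u
    by_cases hu : u ∈ Set.Iic (-Real.log N)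
    · rw [Set.indicator_of_mem hu] at this ⊢
      calc ‖g u‖ ^ 2 ≤ (C * Real.exp (σ * u)) ^ 2 := by gcongr
        _ = _ := by rw [mul_pow, ← Real.exp_nat_mul]; push_cast; ring_nf
    · rw [Set.indicator_of_notMem hu] at this ⊢
      have : ‖g u‖ = 0 := le_antisymm this (norm_nonneg _)
      rw [this]; simp
  have hint1 : Integrable (Set.indicator (Set.Iic (-Real.log N)) (fun u => C * Real.exp (σ * u))) := by
    rw [integrable_indicator_iff measurableSet_Iic]
    exact (integrableOn_exp_mul_Iic hσ _).const_mul C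
  have hint2 : Integrable (Set.indicator (Set.Iic (-Real.log N)) (fun u => C ^ 2 * Real.exp ((2 * σ) * u))) := by
    rw [integrable_indicator_iff measurableSet_Iic]
    exact (integrableOn_exp_mul_Iic (by positivity) _).const_mul _
  have h1 : Integrable g := hint1.mono' hgm.aestronglyMeasurable (Filter.Eventually.of_forall hgb)
  have h2' : Integrable (fun u => ‖g u‖ ^ 2) := hint2.mono' (by fun_prop)
    (Filter.Eventually.of_forall (fun u => by
      rw [Real.norm_of_nonneg (by positivity)]; exact hgb2 u))
  have h2 : MemLp g 2 := (memLp_two_iff_integrable_sq_norm hgm.aestronglyMeasurable).2 h2'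
  obtain ⟨i1, i2⟩ := vor_plancherel_int g h1 h2
  have key : ∀ t : ℝ, mellin f (-(σ + t * Complex.I)) = 𝓕 g (t * (-(2 * Real.pi)⁻¹)) := by
    intro t
    rw [mellin_eq_fourier]
    simp [hg]
    congr 1
    field_simp
  simp only [key]
  have hpi := Real.pi_pos
  have hne : -(2 * Real.pi)⁻¹ ≠ 0 := by simp [hpi.ne']
  refine ⟨i1.comp_mul_right' hne, ?_⟩
  rw [Measure.integral_comp_mul_right (fun t => ‖𝓕 g t‖ ^ 2), i2]
  have : |(-(2 * Real.pi)⁻¹)⁻¹| = 2 * Real.pi := by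
    rw [inv_neg, inv_inv, abs_neg, abs_of_pos (by positivity)]
  rw [this, smul_eq_mul]
  gcongr
  calc ∫ t, ‖g t‖ ^ 2 ≤ ∫ u, Set.indicator (Set.Iic (-Real.log N)) (fun u => C ^ 2 * Real.exp ((2 * σ) * u)) u :=
        integral_mono h2' hint2 hgb2
    _ = C ^ 2 * N ^ (-(2 * σ)) / (2 * σ) := by
        rw [integral_indicator measurableSet_Iic, integral_const_mul, integral_exp_mul_Iic (by positivity),
          Real.rpow_def_of_pos hNpos]
        ring_nf

/-- indicator of coprimality -/
noncomputable def vf (P n : ℕ) : ℂ := if Nat.Coprime P n then 1 else 0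

/-- counting function -/
noncomputable def vA (P : ℕ) (x : ℝ) : ℂ := ∑ k ∈ Finset.Icc 1 ⌊x⌋₊, vf P k

/-- remainder of the counting function -/
noncomputable def vD (P : ℕ) (x : ℝ) : ℂ := vA P x - (Nat.totient P / P : ℂ) * (max x 0 : ℝ)

theorem vf_norm_le (P n : ℕ) : ‖vf P n‖ ≤ 1 := by
  unfold vf; split_ifs <;> simp

theorem vA_measurable (P : ℕ) : Measurable (vA P) := by
  have : vA P = (fun n : ℕ => ∑ k ∈ Finset.Icc 1 n, vf P k) ∘ (fun x : ℝ => ⌊x⌋₊) := rfl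
  rw [this]
  exact (measurable_from_top).comp Nat.measurable_floor

theorem vD_measurable (P : ℕ) : Measurable (vD P) := by
  unfold vD
  apply (vA_measurable P).sub
  fun_prop

theorem vA_norm_le (P : ℕ) (x : ℝ) (hx : 0 ≤ x) : ‖vA P x‖ ≤ x := by
  unfold vA
  calc ‖∑ k ∈ Finset.Icc 1 ⌊x⌋₊, vf P k‖ ≤ ∑ k ∈ Finset.Icc 1 ⌊x⌋₊, (1:ℝ) :=
        norm_sum_le_of_le _ (fun k _ => vf_norm_le P k)
    _ = ⌊x⌋₊ := by simp
    _ ≤ x := Nat.floor_le hx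

theorem vD_bound (P : ℕ) (hP : 0 < P) (x : ℝ) : ‖vD P x‖ ≤ 2 * P + 1 := by
  have hal : (Nat.totient P / P : ℝ) ≤ 1 := by
    rw [div_le_one (by positivity)]; exact_mod_cast Nat.totient_le P
  have hal0 : (0:ℝ) ≤ Nat.totient P / P := by positivity
  set E : ℕ → ℂ := fun n => ∑ k ∈ Finset.Icc 1 n, vf P k - (Nat.totient P / P : ℂ) * n with hE
  have hper : Function.Periodic E P := by
    intro n
    simp only [hE]
    have h1 : ∑ k ∈ Finset.Icc 1 (n + P), vf P k = ∑ k ∈ Finset.Icc 1 n, vf P k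
        + ∑ k ∈ Finset.Ico (n + 1) (n + 1 + P), vf P k := by
      have e1 : ∀ m, Finset.Icc 1 m = Finset.Ico 1 (m + 1) := by
        intro m; ext; simp
      rw [e1, e1, show n + 1 + P = n + P + 1 by ring, Finset.sum_Ico_consecutive _ (by lia) (by lia)]
    have h2 : ∑ k ∈ Finset.Ico (n + 1) (n + 1 + P), vf P k = Nat.totient P := by
      rw [← Nat.filter_coprime_Ico_eq_totient P (n + 1)]
      simp [vf]
    rw [h1, h2]
    have : (P : ℂ) ≠ 0 := by exact_mod_cast hP.ne'
    push_cast
    field_simp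
    ring
  have hEb : ∀ n, ‖E n‖ ≤ 2 * P := by
    intro n
    rw [← hper.map_mod_nat n]
    have hlt := Nat.mod_lt n hP
    set m := n % P
    have hm : (m : ℝ) ≤ P := by exact_mod_cast hlt.le
    have h1 : ‖∑ k ∈ Finset.Icc 1 m, vf P k‖ ≤ m := by
      simpa [vA] using vA_norm_le P m (by positivity)
    have h2 : ‖(Nat.totient P / P : ℂ) * m‖ ≤ m := by
      rw [norm_mul, norm_div, Complex.norm_natCast, Complex.norm_natCast, Complex.norm_natCast]
      exact mul_le_of_le_one_left (by positivity) hal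
    calc ‖E m‖ ≤ _ := norm_sub_le _ _
      _ ≤ _ := by linarith
  have hx : vD P x = E ⌊x⌋₊ - (Nat.totient P / P : ℂ) * ((max x 0 : ℝ) - (⌊x⌋₊ : ℝ) : ℝ) := by
    simp only [vD, hE, vA]; push_cast; ring
  rw [hx]
  have h3 : ‖(Nat.totient P / P : ℂ) * (((max x 0 : ℝ) - (⌊x⌋₊ : ℝ) : ℝ) : ℂ)‖ ≤ 1 := by
    rw [norm_mul, norm_div, Complex.norm_natCast, Complex.norm_natCast, Complex.norm_real]
    apply mul_le_one₀ hal (norm_nonneg _)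
    rw [Real.norm_eq_abs, abs_le]
    rcases le_total 0 x with h | h
    · rw [max_eq_left h]
      have := Nat.floor_le h
      have := Nat.lt_floor_add_one x
      constructor <;> linarith
    · rw [max_eq_right h, Nat.floor_of_nonpos h]; simp
  calc _ ≤ _ := norm_sub_le _ _
    _ ≤ _ := by linarith [hEb ⌊x⌋₊]

open MeasureTheory Filter Asymptotics in
theorem vor_repr1 (P : ℕ) (hP : 0 < P) (N : ℕ) (hN : 1 ≤ N) (s : ℂ) (hs : 1 < s.re) :
    LSeries (vf P) s = ∑ n ∈ Finset.Icc 1 N, vf P n * (n : ℂ) ^ (-s)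
      + (Nat.totient P / P : ℂ) * (N : ℂ) ^ (1 - s) / (s - 1) - vD P N * (N : ℂ) ^ (-s)
      + s * mellin (Set.indicator (Set.Ioi (N : ℝ)) (vD P)) (-s) := by
  have hNpos : (0:ℝ) < N := by exact_mod_cast hN
  have hsum : ∀ g : ℕ → ℂ, (∀ n, ‖g n‖ ≤ 1) → (fun n : ℕ => ∑ k ∈ Finset.Icc 1 n, ‖g k‖) =O[atTop] fun n => (n:ℝ) ^ (1:ℝ) := by
    intro g hg
    apply IsBigO.of_bound 1
    filter_upwards with n
    rw [Real.rpow_one, one_mul, Real.norm_of_nonneg (by positivity), Real.norm_of_nonneg (by positivity)]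
    calc ∑ k ∈ Finset.Icc 1 n, ‖g k‖ ≤ ∑ k ∈ Finset.Icc 1 n, (1:ℝ) := Finset.sum_le_sum (fun k _ => hg k)
      _ = n := by simp
  set g : ℕ → ℂ := fun n => if n ≤ N then 0 else vf P n with hg
  set g' : ℕ → ℂ := fun n => if n ≤ N then vf P n else 0 with hg'
  have hgn : ∀ n, ‖g n‖ ≤ 1 := by
    intro n; simp only [hg]; split_ifs
    · simp
    · exact vf_norm_le P n
  have hgn' : ∀ n, ‖g' n‖ ≤ 1 := by
    intro n; simp only [hg']; split_ifs
    · exact vf_norm_le P n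
    · simp
  have hsplit : LSeries (vf P) s = LSeries g' s + LSeries g s := by
    rw [← LSeries_add (LSeriesSummable_of_sum_norm_bigO (hsum g' hgn') zero_le_one hs)
      (LSeriesSummable_of_sum_norm_bigO (hsum g hgn) zero_le_one hs)]
    congr 1
    ext n
    simp only [hg, hg', Pi.add_apply]
    split_ifs <;> simp
  have h1 : LSeries g' s = ∑ n ∈ Finset.Icc 1 N, vf P n * (n : ℂ) ^ (-s) := by
    unfold LSeries
    rw [tsum_eq_sum (s := Finset.Icc 1 N)]
    · apply Finset.sum_congr rfl
      intro n hn
      have := Finset.mem_Icc.1 hn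
      have e : g' n = vf P n := if_pos this.2
      rw [LSeries.term_of_ne_zero (by lia), e, Complex.cpow_neg, div_eq_mul_inv]
    · intro n hn
      rcases Nat.eq_zero_or_pos n with h | h
      · simp [h]
      · rw [LSeries.term_of_ne_zero (by lia), hg']
        have : ¬ n ≤ N := fun h' => hn (Finset.mem_Icc.2 ⟨h, h'⟩)
        simp [this]
  have h2 := LSeries_eq_mul_integral' g zero_le_one hs (hsum g hgn)
  have hs0 : 0 < s.re := by linarith
  have i1 : IntegrableOn (fun t : ℝ => (t:ℂ) ^ (-s)) (Set.Ioi (N:ℝ)) :=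
    integrableOn_Ioi_cpow_of_lt (by simpa using hs) hNpos
  have i2 : IntegrableOn (fun t : ℝ => (t:ℂ) ^ (-(s + 1))) (Set.Ioi (N:ℝ)) :=
    integrableOn_Ioi_cpow_of_lt (by simpa using hs0) hNpos
  have i3 : IntegrableOn (fun t : ℝ => vD P t * (t:ℂ) ^ (-(s + 1))) (Set.Ioi (N:ℝ)) :=
    Integrable.bdd_mul i2 (vD_measurable P).aestronglyMeasurable
      (Eventually.of_forall (vD_bound P hP))
  have h3 : ∫ t in Set.Ioi (1 : ℝ), (∑ k ∈ Finset.Icc 1 ⌊t⌋₊, g k) * (t:ℂ) ^ (-(s + 1))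
      = ∫ t in Set.Ioi (N : ℝ), (vD P t * (t:ℂ) ^ (-(s + 1)) + (Nat.totient P / P : ℂ) * (t:ℂ) ^ (-s)
        - vA P N * (t:ℂ) ^ (-(s + 1))) := by
    have hsub : Set.Ioi (N:ℝ) ⊆ Set.Ioi 1 := Set.Ioi_subset_Ioi (by exact_mod_cast hN)
    have hh : ∫ t in Set.Ioi (1 : ℝ), (∑ k ∈ Finset.Icc 1 ⌊t⌋₊, g k) * (t:ℂ) ^ (-(s + 1))
        = ∫ t in Set.Ioi (N : ℝ), (∑ k ∈ Finset.Icc 1 ⌊t⌋₊, g k) * (t:ℂ) ^ (-(s + 1)) := by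
      apply setIntegral_eq_of_subset_of_forall_sdiff_eq_zero measurableSet_Ioi hsub
      intro t ht
      have : t ≤ N := by simpa using ht.2
      have : ⌊t⌋₊ ≤ N := by
        have := Nat.floor_le_floor this
        simpa using this
      rw [Finset.sum_eq_zero, zero_mul]
      intro k hk
      have := (Finset.mem_Icc.1 hk).2
      simp only [hg]; rw [if_pos (by lia)]
    rw [hh]
    · apply setIntegral_congr_fun measurableSet_Ioi
      intro t ht
      have ht' : (N:ℝ) < t := ht
      have ht0 : (t:ℂ) ≠ 0 := by
        have : (0:ℝ) < t := hNpos.trans ht'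
        exact_mod_cast this.ne'
      have hNt : N ≤ ⌊t⌋₊ := Nat.le_floor ht'.le
      have e1 : ∑ k ∈ Finset.Icc 1 ⌊t⌋₊, g k = vA P t - vA P N := by
        have hu : vA P t - vA P N = ∑ k ∈ Finset.Icc 1 ⌊t⌋₊, vf P k - ∑ k ∈ Finset.Icc 1 N, vf P k := by simp [vA]
        rw [hu]
        have hu2 : ∑ k ∈ Finset.Icc 1 N, vf P k = ∑ k ∈ Finset.Icc 1 ⌊t⌋₊, (if k ≤ N then vf P k else 0) := by
          rw [← Finset.sum_filter]
          congr 1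
          ext k; simp; lia
        rw [hu2, ← Finset.sum_sub_distrib]
        apply Finset.sum_congr rfl
        intro k _
        simp only [hg]
        split_ifs <;> simp
      have e2 : vA P t = vD P t + (Nat.totient P / P : ℂ) * t := by
        simp only [vD]
        rw [max_eq_left (hNpos.trans ht').le]; ring
      have e3 : (t:ℂ) ^ (-s) = t * (t:ℂ) ^ (-(s + 1)) := by
        rw [show -s = 1 + (-(s + 1)) by ring, Complex.cpow_add _ _ ht0, Complex.cpow_one]
      simp only
      rw [e1, e2, e3]; ring
  have h4 : mellin (Set.indicator (Set.Ioi (N : ℝ)) (vD P)) (-s) = ∫ t in Set.Ioi (N : ℝ), vD P t * (t:ℂ) ^ (-(s + 1)) := by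
    unfold mellin
    have : ∀ t : ℝ, (t:ℂ) ^ (-s - 1) • Set.indicator (Set.Ioi (N : ℝ)) (vD P) t
        = Set.indicator (Set.Ioi (N : ℝ)) (fun t : ℝ => vD P t * (t:ℂ) ^ (-(s + 1))) t := by
      intro t
      by_cases ht : t ∈ Set.Ioi (N:ℝ)
      · rw [Set.indicator_of_mem ht, Set.indicator_of_mem ht, smul_eq_mul, mul_comm]
        ring_nf
      · rw [Set.indicator_of_notMem ht, Set.indicator_of_notMem ht]; simp
    simp_rw [this]
    rw [setIntegral_indicator measurableSet_Ioi]
    congr 2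
    rw [Set.inter_eq_right]
    exact Set.Ioi_subset_Ioi hNpos.le
  have h5 : ∫ t : ℝ in Set.Ioi (N : ℝ), (t:ℂ) ^ (-s) = (N:ℂ) ^ (1 - s) / (s - 1) := by
    have := integral_Ioi_cpow_of_lt (a := -s) (by simpa using hs) hNpos
    rw [this]
    have : s - 1 ≠ 0 := by
      intro h; rw [sub_eq_zero] at h; rw [h] at hs; simp at hs
    rw [show -s + 1 = -(s - 1) by ring, div_neg, neg_div, neg_neg, show 1 - s = -(s - 1) by ring]
    simp
  have hs00 : s ≠ 0 := by intro h; rw [h] at hs0; simp at hs0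
  have h6 : ∫ t : ℝ in Set.Ioi (N : ℝ), (t:ℂ) ^ (-(s + 1)) = (N:ℂ) ^ (-s) / s := by
    have := integral_Ioi_cpow_of_lt (a := -(s + 1)) (by simpa using hs0) hNpos
    rw [this, show -(s + 1) + 1 = -s by ring, div_neg, neg_div, neg_neg]
    simp
  have i4 := i3.add (i1.const_mul (Nat.totient P / P : ℂ))
  have i5 := i2.const_mul (vA P N)
  have h7 := integral_sub i4 i5
  simp only [Pi.add_apply] at h7
  rw [hsplit, h1, h2, h3, h7,
    integral_add i3 (i1.const_mul _), integral_const_mul, integral_const_mul, h5, h6, ← h4]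
  have e2 : vA P N = vD P N + (Nat.totient P / P : ℂ) * N := by
    simp only [vD]
    rw [max_eq_left hNpos.le]; push_cast; ring
  have e3 : (N:ℂ) ^ (1 - s) = N * (N:ℂ) ^ (-s) := by
    rw [show 1 - s = 1 + (-s) by ring, Complex.cpow_add _ _ (by exact_mod_cast hNpos.ne'), Complex.cpow_one]
  have : s - 1 ≠ 0 := by
      intro h; rw [sub_eq_zero] at h; rw [h] at hs; simp at hs
  rw [e2, e3]
  field_simp
  ring

theorem vf_eq_char (P : ℕ) [NeZero P] (n : ℕ) : (1 : DirichletCharacter ℂ P) n = vf P n := by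
  unfold vf
  split_ifs with h
  · exact MulChar.one_apply ((ZMod.isUnit_iff_coprime n P).2 h.symm)
  · apply MulChar.map_nonunit
    rw [ZMod.isUnit_iff_coprime]
    exact fun heq => h heq.symm

/-- the zeta function with Euler factors at primes dividing `P` removed -/
noncomputable def vL (P : ℕ) (s : ℂ) : ℂ :=
  (∏ p ∈ P.primeFactors, (1 - (p : ℂ) ^ (-s))) * riemannZeta s

theorem vL_differentiableAt (P : ℕ) (s : ℂ) (hs : s ≠ 1) : DifferentiableAt ℂ (vL P) s := by
  unfold vL
  apply DifferentiableAt.mul _ (differentiableAt_riemannZeta hs)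
  apply DifferentiableAt.fun_finsetProd
  intro p hp
  have := (Nat.prime_of_mem_primeFactors hp).ne_zero
  have hp0 : (p:ℂ) ≠ 0 := by exact_mod_cast this
  apply DifferentiableAt.sub (by fun_prop)
  apply DifferentiableAt.const_cpow (by fun_prop)
  left; exact hp0

open MeasureTheory Filter Asymptotics in
theorem vor_repr (P : ℕ) (hP : 0 < P) (N : ℕ) (hN : 1 ≤ N) (s : ℂ) (hs : 0 < s.re) (hs' : 0 < s.im) :
    vL P s = ∑ n ∈ Finset.Icc 1 N, vf P n * (n : ℂ) ^ (-s)
      + (Nat.totient P / P : ℂ) * (N : ℂ) ^ (1 - s) / (s - 1) - vD P N * (N : ℂ) ^ (-s)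
      + s * mellin (Set.indicator (Set.Ioi (N : ℝ)) (vD P)) (-s) := by
  have hNpos : (0:ℝ) < N := by exact_mod_cast hN
  have hN0 : (N:ℂ) ≠ 0 := by exact_mod_cast hNpos.ne'
  have : NeZero P := ⟨hP.ne'⟩
  set U : Set ℂ := {z | 0 < z.re ∧ 0 < z.im} with hU
  have hUo : IsOpen U := (isOpen_lt continuous_const Complex.continuous_re).inter
    (isOpen_lt continuous_const Complex.continuous_im)
  have hUc : Convex ℝ U := (convex_halfSpace_re_gt 0).inter (convex_halfSpace_im_gt 0)
  have hne1 : ∀ z ∈ U, z ≠ 1 := by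
    rintro z ⟨_, h⟩ rfl; simp at h
  have hL : AnalyticOnNhd ℂ (vL P) U :=
    DifferentiableOn.analyticOnNhd (fun z hz => (vL_differentiableAt P z (hne1 z hz)).differentiableWithinAt) hUo
  set R : ℂ → ℂ := fun s => ∑ n ∈ Finset.Icc 1 N, vf P n * (n : ℂ) ^ (-s)
      + (Nat.totient P / P : ℂ) * (N : ℂ) ^ (1 - s) / (s - 1) - vD P N * (N : ℂ) ^ (-s)
      + s * mellin (Set.indicator (Set.Ioi (N : ℝ)) (vD P)) (-s) with hR
  have hRd : AnalyticOnNhd ℂ R U := by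
    apply DifferentiableOn.analyticOnNhd _ hUo
    intro z hz
    apply DifferentiableAt.differentiableWithinAt
    have hz1 : z - 1 ≠ 0 := sub_ne_zero.2 (hne1 z hz)
    have d1 : ∀ c : ℂ, c ≠ 0 → DifferentiableAt ℂ (fun s : ℂ => c ^ (-s)) z := by
      intro c hc
      exact DifferentiableAt.const_cpow (by fun_prop) (Or.inl hc)
    have d2 : DifferentiableAt ℂ (fun s : ℂ => (N:ℂ) ^ (1 - s)) z :=
      DifferentiableAt.const_cpow (by fun_prop) (Or.inl hN0)
    have d3 : DifferentiableAt ℂ (mellin (Set.indicator (Set.Ioi (N : ℝ)) (vD P))) (-z) := by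
      have hb := vD_bound P hP
      apply mellin_differentiableAt_of_isBigO_rpow (a := 0) (b := -z.re - 1)
      · apply LocallyIntegrable.locallyIntegrableOn
        have hloc : LocallyIntegrable (fun _ : ℝ => (2 * P + 1 : ℝ)) volume := locallyIntegrable_const _
        apply hloc.mono ((vD_measurable P).indicator measurableSet_Ioi).aestronglyMeasurable
        filter_upwards with x
        rw [Real.norm_of_nonneg (by positivity)]
        exact (norm_indicator_le_norm_self _ _).trans (hb x)
      · apply IsBigO.of_bound (2 * P + 1)
        filter_upwards with x
        simp only [neg_zero, Real.rpow_zero, norm_one, mul_one]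
        exact (norm_indicator_le_norm_self _ _).trans (hb x)
      · simpa using hz.1
      · apply IsBigO.of_bound 1
        filter_upwards [Ioo_mem_nhdsGT hNpos] with x hx
        rw [Set.indicator_of_notMem (by simpa using hx.2.le)]
        simp
      · simp
    have d4 : DifferentiableAt ℂ (fun s : ℂ => mellin (Set.indicator (Set.Ioi (N : ℝ)) (vD P)) (-s)) z :=
      d3.comp z (by fun_prop)
    have d5 : DifferentiableAt ℂ (fun s : ℂ => ∑ n ∈ Finset.Icc 1 N, vf P n * (n : ℂ) ^ (-s)) z := by
      apply DifferentiableAt.fun_sum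
      intro n hn
      have : n ≠ 0 := by have := (Finset.mem_Icc.1 hn).1; lia
      exact (d1 n (by exact_mod_cast this)).const_mul _
    exact ((d5.add ((d2.const_mul _).div (by fun_prop) hz1)).sub ((d1 N hN0).const_mul _)).add
      (differentiableAt_id.mul d4)
  have hz0 : (2 + Complex.I) ∈ U := by constructor <;> simp
  have hev : vL P =ᶠ[nhds (2 + Complex.I)] R := by
    have : {z : ℂ | 1 < z.re} ∈ nhds (2 + Complex.I) :=
      (isOpen_lt continuous_const Complex.continuous_re).mem_nhds (by simp)
    filter_upwards [this] with z hz
    have hz1 : z ≠ 1 := by rintro rfl; simp at hz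
    have e := DirichletCharacter.LFunctionTrivChar_eq_mul_riemannZeta (N := P) hz1
    rw [vL, ← e]
    have := vor_repr1 P hP N hN z hz
    have hRz : R z = LSeries (vf P) z := this.symm
    rw [hRz, DirichletCharacter.LFunctionTrivChar, DirichletCharacter.LFunction_eq_LSeries _ hz]
    congr 1
    ext n
    exact vf_eq_char P n
  exact hL.eqOn_of_preconnected_of_eventuallyEq hRd hUc.isPreconnected hz0 hev ⟨hs, hs'⟩


theorem vor_exp_int (c : ℝ) (hc : c ≠ 0) (A B : ℝ) :
    ‖∫ t in A..B, Complex.exp ((c * Complex.I) * t)‖ ≤ 2 / |c| := by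
  have hc' : (c * Complex.I : ℂ) ≠ 0 := by simp [hc]
  rw [integral_exp_mul_complex hc', norm_div]
  have e : ∀ x : ℝ, ‖Complex.exp (c * Complex.I * x)‖ = 1 := by
    intro x
    rw [show (c * Complex.I * x : ℂ) = ((c * x : ℝ) : ℂ) * Complex.I by push_cast; ring]
    exact Complex.norm_exp_ofReal_mul_I _
  have h : ‖(c * Complex.I : ℂ)‖ = |c| := by simp
  rw [h]
  gcongr
  calc _ ≤ _ := norm_sub_le _ _
    _ = 2 := by rw [e, e]; norm_num

theorem vor_log_sub (m n X : ℕ) (hm : 1 ≤ m) (hn : 1 ≤ n) (hmX : m ≤ X) (hnX : n ≤ X) (hmn : m ≠ n) :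
    2 / |Real.log m - Real.log n| ≤ 2 * X * (1 / |(m:ℝ) - n|) := by
  wlog h : m < n generalizing m n
  · have := this n m hn hm hnX hmX hmn.symm (by lia)
    rwa [abs_sub_comm, abs_sub_comm (m:ℝ)]
  have hm' : (0:ℝ) < m := by exact_mod_cast hm
  have hn' : (0:ℝ) < n := by exact_mod_cast hn
  have hX' : (n:ℝ) ≤ X := by exact_mod_cast hnX
  have hlt : (m:ℝ) < n := by exact_mod_cast h
  have h1 : ((n:ℝ) - m) / X ≤ Real.log n - Real.log m := by
    rw [← Real.log_div hn'.ne' hm'.ne']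
    have := Real.one_sub_inv_le_log_of_pos (x := (n:ℝ) / m) (by positivity)
    refine le_trans ?_ this
    rw [inv_div, one_sub_div hn'.ne']
    gcongr
  have hX0 : (0:ℝ) < X := by linarith
  have h2 : 0 < ((n:ℝ) - m) / X := div_pos (by linarith) hX0
  rw [abs_sub_comm, abs_sub_comm (m:ℝ), abs_of_pos (by linarith : (0:ℝ) < n - m), abs_of_pos (by linarith)]
  calc 2 / (Real.log n - Real.log m) ≤ 2 / (((n:ℝ) - m) / X) := by gcongr
    _ = _ := by field_simp

theorem vor_harm (X m : ℕ) (hm : 1 ≤ m) (hmX : m ≤ X) :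
    ∑ n ∈ (Finset.Icc 1 X).erase m, 1 / |(m:ℝ) - n| ≤ 2 * (harmonic X : ℝ) := by
  have hh : (harmonic X : ℝ) = ∑ d ∈ Finset.Icc 1 X, 1 / (d:ℝ) := by
    rw [harmonic_eq_sum_Icc]; push_cast; simp
  have e : (Finset.Icc 1 X).erase m = Finset.Ico 1 m ∪ Finset.Ioc m X := by
    ext k; simp; lia
  have hd : Disjoint (Finset.Ico 1 m) (Finset.Ioc m X) := by
    rw [Finset.disjoint_left]; intro k; simp; lia
  rw [e, Finset.sum_union hd, two_mul, hh]
  apply add_le_add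
  · have : ∑ n ∈ Finset.Ico 1 m, 1 / |(m:ℝ) - n| = ∑ d ∈ Finset.Ico 1 m, 1 / (d:ℝ) := by
      apply Finset.sum_bij (fun n _ => m - n)
      · intro a ha; simp at ha ⊢; lia
      · intro a ha b hb; simp at ha hb; lia
      · intro b hb; simp at hb; exact ⟨m - b, by simp; lia, by lia⟩
      · intro a ha
        simp at ha
        rw [Nat.cast_sub (by lia), abs_of_pos]
        have : (a:ℝ) < m := by exact_mod_cast ha.2
        linarith
    rw [this]
    apply Finset.sum_le_sum_of_subset_of_nonneg
    · intro k; simp; lia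
    · intros; positivity
  · have : ∑ n ∈ Finset.Ioc m X, 1 / |(m:ℝ) - n| = ∑ d ∈ Finset.Icc 1 (X - m), 1 / (d:ℝ) := by
      apply Finset.sum_bij (fun n _ => n - m)
      · intro a ha; simp at ha ⊢; lia
      · intro a ha b hb; simp at ha hb; lia
      · intro b hb; simp at hb; exact ⟨m + b, by simp; lia, by lia⟩
      · intro a ha
        simp at ha
        rw [Nat.cast_sub (by lia), abs_sub_comm, abs_of_pos]
        have : (m:ℝ) < a := by exact_mod_cast ha.1
        linarith
    rw [this]
    apply Finset.sum_le_sum_of_subset_of_nonneg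
    · intro k; simp; lia
    · intros; positivity

/-- mean value theorem for Dirichlet polynomials -/
theorem vor_mv {ι : Type*} (I : Finset ι) (ν : ι → ℕ) (hinj : Set.InjOn ν I) (X : ℕ)
    (h1 : ∀ i ∈ I, 1 ≤ ν i) (h2 : ∀ i ∈ I, ν i ≤ X) (a : ι → ℂ) (A B : ℝ) :
    |(∫ t in A..B, ‖∑ i ∈ I, a i * (ν i : ℂ) ^ (-(t * Complex.I))‖ ^ 2)
      - (B - A) * ∑ i ∈ I, ‖a i‖ ^ 2| ≤ 4 * X * (harmonic X : ℝ) * ∑ i ∈ I, ‖a i‖ ^ 2 := by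
  classical
  have hpw : ∀ i ∈ I, ∀ t : ℝ, (ν i : ℂ) ^ (-(t * Complex.I)) = Complex.exp ((-Real.log (ν i) : ℝ) * Complex.I * t) := by
    intro i hi t
    have : (ν i : ℂ) ≠ 0 := by have := h1 i hi; exact_mod_cast (by lia : ν i ≠ 0)
    rw [Complex.cpow_def_of_ne_zero this, ← Complex.natCast_log]
    congr 1; push_cast; ring
  set G : ι → ι → ℝ → ℂ := fun i j t => a i * (starRingEnd ℂ) (a j) *
    Complex.exp ((Real.log (ν j) - Real.log (ν i) : ℝ) * Complex.I * t) with hG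
  have hsq : ∀ t : ℝ, ((‖∑ i ∈ I, a i * (ν i : ℂ) ^ (-(t * Complex.I))‖ ^ 2 : ℝ) : ℂ)
      = ∑ i ∈ I, ∑ j ∈ I, G i j t := by
    intro t
    rw [← Complex.normSq_eq_norm_sq, ← Complex.mul_conj, map_sum, Finset.sum_mul_sum]
    apply Finset.sum_congr rfl; intro i hi
    apply Finset.sum_congr rfl; intro j hj
    rw [hpw i hi, hpw j hj, map_mul, ← Complex.exp_conj, hG]
    simp only [map_mul, Complex.conj_ofReal, Complex.conj_I]
    rw [mul_mul_mul_comm, ← Complex.exp_add]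
    congr 2
    push_cast; ring
  have hGi : ∀ i j, IntervalIntegrable (G i j) MeasureTheory.volume A B := by
    intro i j
    apply Continuous.intervalIntegrable
    simp only [hG]; fun_prop
  have hintg : ((∫ t in A..B, ‖∑ i ∈ I, a i * (ν i : ℂ) ^ (-(t * Complex.I))‖ ^ 2 : ℝ) : ℂ)
      = ∑ i ∈ I, ∑ j ∈ I, ∫ t in A..B, G i j t := by
    rw [← intervalIntegral.integral_ofReal]
    simp_rw [hsq]
    rw [intervalIntegral.integral_finsetSum]
    · apply Finset.sum_congr rfl; intro i _
      rw [intervalIntegral.integral_finsetSum]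
      intro j _; exact hGi i j
    · intro i _
      have : (fun t => ∑ j ∈ I, G i j t) = ∑ j ∈ I, G i j := by ext; simp
      rw [this]
      apply IntervalIntegrable.sum
      intro j _; exact hGi i j
  have hdiag : ∀ i, ∫ t in A..B, G i i t = ((B - A) * ‖a i‖ ^ 2 : ℝ) := by
    intro i
    simp only [hG, sub_self, Complex.mul_conj, Complex.normSq_eq_norm_sq]
    simp
  have hmain : ((((∫ t in A..B, ‖∑ i ∈ I, a i * (ν i : ℂ) ^ (-(t * Complex.I))‖ ^ 2)
      - (B - A) * ∑ i ∈ I, ‖a i‖ ^ 2) : ℝ) : ℂ) = ∑ i ∈ I, ∑ j ∈ I.erase i, ∫ t in A..B, G i j t := by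
    rw [Complex.ofReal_sub, hintg, Finset.mul_sum, Complex.ofReal_sum, ← Finset.sum_sub_distrib]
    apply Finset.sum_congr rfl; intro i hi
    rw [← Finset.add_sum_erase I _ hi, hdiag]; ring
  have hoff : ∀ i ∈ I, ∀ j ∈ I.erase i, ‖∫ t in A..B, G i j t‖ ≤
      (‖a i‖ ^ 2 + ‖a j‖ ^ 2) * (X * (1 / |(ν i : ℝ) - ν j|)) := by
    intro i hi j hj
    have hj' := Finset.mem_erase.1 hj
    have hne : ν i ≠ ν j := fun h => hj'.1 (hinj hi hj'.2 h).symm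
    simp only [hG]
    rw [intervalIntegral.integral_const_mul, norm_mul, norm_mul, RCLike.norm_conj]
    have hlog : Real.log (ν j) - Real.log (ν i) ≠ 0 := by
      intro h
      rw [sub_eq_zero] at h
      have := Real.log_injOn_pos (Set.mem_Ioi.2 (Nat.cast_pos.2 (h1 j hj'.2))) (Set.mem_Ioi.2 (Nat.cast_pos.2 (h1 i hi))) h
      exact hne (by exact_mod_cast this.symm)
    have b1 := vor_exp_int _ hlog A B
    have b2 := vor_log_sub (ν j) (ν i) X (h1 j hj'.2) (h1 i hi) (h2 j hj'.2) (h2 i hi) hne.symm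
    rw [abs_sub_comm (ν j : ℝ)] at b2
    have b3 := b1.trans b2
    have hpos : (0:ℝ) ≤ X * (1 / |(ν i : ℝ) - ν j|) := by positivity
    calc _ ≤ ‖a i‖ * ‖a j‖ * (2 * X * (1 / |(ν i : ℝ) - ν j|)) := by gcongr
      _ = (2 * ‖a i‖ * ‖a j‖) * (X * (1 / |(ν i : ℝ) - ν j|)) := by ring
      _ ≤ _ := by gcongr; nlinarith [sq_nonneg (‖a i‖ - ‖a j‖)]
  have hrow : ∀ i ∈ I, ∑ j ∈ I.erase i, 1 / |(ν i : ℝ) - ν j| ≤ 2 * (harmonic X : ℝ) := by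
    intro i hi
    refine le_trans ?_ (vor_harm X (ν i) (h1 i hi) (h2 i hi))
    have : ∑ j ∈ I.erase i, 1 / |(ν i : ℝ) - ν j| = ∑ m ∈ (I.erase i).image ν, 1 / |(ν i : ℝ) - m| := by
      rw [Finset.sum_image]
      exact hinj.mono (by simp)
    rw [this]
    apply Finset.sum_le_sum_of_subset_of_nonneg
    · intro m hm
      obtain ⟨j, hj, rfl⟩ := Finset.mem_image.1 hm
      have hj' := Finset.mem_erase.1 hj
      rw [Finset.mem_erase, Finset.mem_Icc]
      exact ⟨fun h => hj'.1 (hinj hj'.2 hi h), h1 j hj'.2, h2 j hj'.2⟩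
    · intros; positivity
  have key : ∑ i ∈ I, ∑ j ∈ I.erase i, ‖a j‖ ^ 2 * (1 / |(ν i : ℝ) - ν j|)
      = ∑ i ∈ I, ∑ j ∈ I.erase i, ‖a i‖ ^ 2 * (1 / |(ν i : ℝ) - ν j|) := by
    rw [Finset.sum_comm' (t' := I) (s' := fun j => I.erase j)]
    · apply Finset.sum_congr rfl; intro i _
      apply Finset.sum_congr rfl; intro j _
      rw [abs_sub_comm]
    · intro x y; simp only [Finset.mem_erase]; tauto
  have hle : ∑ i ∈ I, ∑ j ∈ I.erase i, ‖a i‖ ^ 2 * (1 / |(ν i : ℝ) - ν j|) ≤ 2 * (harmonic X : ℝ) * ∑ i ∈ I, ‖a i‖ ^ 2 := by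
    rw [Finset.mul_sum]
    apply Finset.sum_le_sum; intro i hi
    rw [← Finset.mul_sum, mul_comm]
    gcongr
    exact hrow i hi
  rw [← Real.norm_eq_abs, ← Complex.norm_real, hmain]
  calc _ ≤ ∑ i ∈ I, ∑ j ∈ I.erase i, (‖a i‖ ^ 2 + ‖a j‖ ^ 2) * (X * (1 / |(ν i : ℝ) - ν j|)) :=
        norm_sum_le_of_le _ (fun i hi => norm_sum_le_of_le _ (fun j hj => hoff i hi j hj))
    _ = X * (∑ i ∈ I, ∑ j ∈ I.erase i, ‖a i‖ ^ 2 * (1 / |(ν i : ℝ) - ν j|)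
        + ∑ i ∈ I, ∑ j ∈ I.erase i, ‖a j‖ ^ 2 * (1 / |(ν i : ℝ) - ν j|)) := by
        rw [← Finset.sum_add_distrib, Finset.mul_sum]
        apply Finset.sum_congr rfl; intro i _
        rw [← Finset.sum_add_distrib, Finset.mul_sum]
        apply Finset.sum_congr rfl; intro j _
        ring
    _ ≤ X * (2 * (harmonic X : ℝ) * ∑ i ∈ I, ‖a i‖ ^ 2 + 2 * (harmonic X : ℝ) * ∑ i ∈ I, ‖a i‖ ^ 2) := by
        rw [key]; gcongr
    _ = _ := by ring


/-- Fejer-type weight -/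
noncomputable def vQ (S : Finset ℕ) (ω : ℕ → ℂ) (J : ℕ) (t : ℝ) : ℂ :=
  ∏ p ∈ S, ∑ j ∈ Finset.range J, ((p : ℂ) ^ (-(t * Complex.I)) * (starRingEnd ℂ) (ω p)) ^ j

theorem vor_cpow_norm (p : ℕ) (hp : p ≠ 0) (t : ℝ) : ‖(p : ℂ) ^ (-(t * Complex.I))‖ = 1 := by
  rw [Complex.norm_natCast_cpow_of_pos (by lia)]; simp

theorem vor_cpow_cont (p : ℕ) (hp : p ≠ 0) : Continuous (fun t : ℝ => (p : ℂ) ^ (-(t * Complex.I))) := by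
  apply Continuous.const_cpow (by fun_prop)
  left; exact_mod_cast hp

theorem vQ_cont (S : Finset ℕ) (hS : ∀ p ∈ S, p.Prime) (ω : ℕ → ℂ) (J : ℕ) : Continuous (vQ S ω J) := by
  unfold vQ
  apply continuous_finsetProd
  intro p hp
  have := vor_cpow_cont p (hS p hp).ne_zero
  fun_prop

theorem vQ_norm_le (S : Finset ℕ) (hS : ∀ p ∈ S, p.Prime) (ω : ℕ → ℂ) (hω : ∀ p, ‖ω p‖ = 1) (J : ℕ) (t : ℝ) :
    ‖vQ S ω J t‖ ≤ (J : ℝ) ^ S.card := by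
  unfold vQ
  rw [norm_prod]
  rw [← Finset.prod_const]
  apply Finset.prod_le_prod
  · intros; positivity
  intro p hp
  calc _ ≤ ∑ j ∈ Finset.range J, (1:ℝ) := by
        apply norm_sum_le_of_le
        intro j _
        rw [norm_pow, norm_mul, vor_cpow_norm p (hS p hp).ne_zero, RCLike.norm_conj, hω]; simp
    _ = J := by simp

theorem vQ_expand (S : Finset ℕ) (hS : ∀ p ∈ S, p.Prime) (ω : ℕ → ℂ) (hω : ∀ p, ‖ω p‖ = 1) (J : ℕ) :
    ∃ (M : Finset ℕ) (c : ℕ → ℂ), M.card = J ^ S.card ∧ (∀ m ∈ M, m ≠ 0 ∧ m.primeFactors ⊆ S) ∧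
      (∀ m, ‖c m‖ = 1) ∧ ∀ t : ℝ, vQ S ω J t = ∑ m ∈ M, c m * (m : ℂ) ^ (-(t * Complex.I)) := by
  classical
  induction S using Finset.induction_on with
  | empty =>
    refine ⟨{1}, fun _ => 1, by simp, by simp, by simp, by simp [vQ]⟩
  | insert p S hp ih =>
    obtain ⟨M, c, h1, h2, h3, h4⟩ := ih (fun q hq => hS q (Finset.mem_insert_of_mem hq))
    have hpp : p.Prime := hS p (Finset.mem_insert_self _ _)
    have hpm : ∀ m ∈ M, ¬ p ∣ m := by
      intro m hm hd
      exact hp ((h2 m hm).2 (Nat.mem_primeFactors.2 ⟨hpp, hd, (h2 m hm).1⟩))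
    have hfac : ∀ j, ∀ m ∈ M, (p ^ j * m).factorization p = j := by
      intro j m hm
      rw [Nat.factorization_mul (pow_ne_zero _ hpp.ne_zero) (h2 m hm).1, hpp.factorization_pow]
      simp [Nat.factorization_eq_zero_of_not_dvd (hpm m hm)]
    have hdiv : ∀ j, ∀ m ∈ M, (p ^ j * m) / p ^ ((p ^ j * m).factorization p) = m := by
      intro j m hm
      rw [hfac j m hm]
      exact Nat.mul_div_cancel_left _ (pow_pos hpp.pos _)
    have hinj : Set.InjOn (fun x : ℕ × ℕ => p ^ x.1 * x.2) (Finset.range J ×ˢ M : Finset (ℕ × ℕ)) := by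
      rintro ⟨j, m⟩ hx ⟨j', m'⟩ hx' h
      simp only [Finset.coe_product, Set.mem_prod, Finset.mem_coe] at hx hx'
      simp only at h
      have e1 := hfac j m hx.2
      have e2 := hdiv j m hx.2
      rw [h, hfac j' m' hx'.2] at e1
      rw [h, hdiv j' m' hx'.2] at e2
      simp [e1, e2]
    refine ⟨(Finset.range J ×ˢ M).image (fun x => p ^ x.1 * x.2),
      fun x => (starRingEnd ℂ) (ω p) ^ (x.factorization p) * c (x / p ^ (x.factorization p)), ?_, ?_, ?_, ?_⟩
    · rw [Finset.card_image_of_injOn hinj, Finset.card_product, Finset.card_range, h1,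
        Finset.card_insert_of_notMem hp, pow_succ']
    · intro x hx
      obtain ⟨⟨j, m⟩, hjm, rfl⟩ := Finset.mem_image.1 hx
      have hm := (Finset.mem_product.1 hjm).2
      simp only at hm ⊢
      refine ⟨mul_ne_zero (pow_ne_zero _ hpp.ne_zero) (h2 m hm).1, ?_⟩
      rw [Nat.primeFactors_mul (pow_ne_zero _ hpp.ne_zero) (h2 m hm).1]
      apply Finset.union_subset
      · intro q hq
        have := Nat.mem_primeFactors.1 hq
        have h5 := (Nat.prime_dvd_prime_iff_eq this.1 hpp).1 (this.1.dvd_of_dvd_pow this.2.1)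
        rw [h5]; exact Finset.mem_insert_self _ _
      · exact (h2 m hm).2.trans (Finset.subset_insert _ _)
    · intro m; simp [h3, hω]
    · intro t
      rw [Finset.sum_image hinj, Finset.sum_product]
      have : vQ (insert p S) ω J t = (∑ j ∈ Finset.range J, ((p : ℂ) ^ (-(t * Complex.I)) * (starRingEnd ℂ) (ω p)) ^ j)
          * vQ S ω J t := by
        unfold vQ; rw [Finset.prod_insert hp]
      rw [this, h4, Finset.sum_mul_sum]
      apply Finset.sum_congr rfl; intro j _
      apply Finset.sum_congr rfl; intro m hm
      simp only
      rw [hdiv j m hm, hfac j m hm]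
      rw [Nat.cast_mul, Complex.natCast_mul_natCast_cpow, Nat.cast_pow, mul_pow]
      have : ((p:ℂ) ^ j) ^ (-(t * Complex.I)) = ((p:ℂ) ^ (-(t * Complex.I))) ^ j := by
        rw [← Complex.cpow_nat_mul, mul_comm, Complex.natCast_cpow_natCast_mul]
      rw [this]; ring

theorem vQ_erase (S : Finset ℕ) (hS : ∀ p ∈ S, p.Prime) (ω : ℕ → ℂ) (hω : ∀ p, ‖ω p‖ = 1) (J : ℕ) (t : ℝ)
    (p : ℕ) (hp : p ∈ S) :
    ‖vQ S ω J t‖ ^ 2 * ‖(p : ℂ) ^ (-(t * Complex.I)) - ω p‖ ^ 2 ≤ 4 * ‖vQ (S.erase p) ω J t‖ ^ 2 := by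
  classical
  have e : vQ S ω J t = (∑ j ∈ Finset.range J, ((p : ℂ) ^ (-(t * Complex.I)) * (starRingEnd ℂ) (ω p)) ^ j)
      * vQ (S.erase p) ω J t := by
    unfold vQ; rw [Finset.mul_prod_erase S (fun p => ∑ j ∈ Finset.range J, ((p : ℂ) ^ (-(t * Complex.I)) * (starRingEnd ℂ) (ω p)) ^ j) hp]
  set z := (p : ℂ) ^ (-(t * Complex.I)) * (starRingEnd ℂ) (ω p) with hz
  have hz1 : ‖z‖ = 1 := by
    rw [hz, norm_mul, vor_cpow_norm p (hS p hp).ne_zero, RCLike.norm_conj, hω]; simp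
  have hωω : (starRingEnd ℂ) (ω p) * ω p = 1 := by
    rw [mul_comm, Complex.mul_conj, Complex.normSq_eq_norm_sq, hω]; simp
  have e2 : (p : ℂ) ^ (-(t * Complex.I)) - ω p = (z - 1) * ω p := by
    rw [hz, sub_mul, mul_assoc, hωω]; ring
  have e3 : (∑ j ∈ Finset.range J, z ^ j) * (z - 1) = z ^ J - 1 := geom_sum_mul z J
  have e4 : ‖z ^ J - 1‖ ≤ 2 := by
    calc _ ≤ _ := norm_sub_le _ _
      _ = 2 := by rw [norm_pow, hz1]; norm_num
  rw [← mul_pow, ← norm_mul, e, e2]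
  rw [show (∑ j ∈ Finset.range J, z ^ j) * vQ (S.erase p) ω J t * ((z - 1) * ω p)
    = ((∑ j ∈ Finset.range J, z ^ j) * (z - 1)) * (vQ (S.erase p) ω J t * ω p) by ring, e3, norm_mul, norm_mul, hω, mul_one, mul_pow]
  gcongr
  nlinarith [norm_nonneg (z ^ J - 1)]


theorem vor_coprime (S : Finset ℕ) (P : ℕ) (hP : P.primeFactors = S) (hP0 : P ≠ 0) (m n : ℕ) (hm : m ≠ 0)
    (hmS : m.primeFactors ⊆ S) (h : Nat.Coprime P n) : Nat.Coprime m n := by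
  apply Nat.coprime_of_dvd
  intro k hk hkm hkn
  have h1 : k ∈ S := hmS (Nat.mem_primeFactors.2 ⟨hk, hkm, hm⟩)
  rw [← hP] at h1
  have := Nat.dvd_gcd (Nat.dvd_of_mem_primeFactors h1) hkn
  rw [h] at this
  exact hk.one_lt.ne' (Nat.dvd_one.1 this)

/-- the polynomial part -/
noncomputable def vP (P N : ℕ) (s : ℂ) : ℂ := ∑ n ∈ Finset.Icc 2 N, vf P n * (n : ℂ) ^ (-s)

theorem vP_cont (P N : ℕ) (s0 : ℂ) : Continuous (fun t : ℝ => vP P N (s0 + t * Complex.I)) := by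
  unfold vP
  apply continuous_finsetSum
  intro n hn
  have : n ≠ 0 := by have := (Finset.mem_Icc.1 hn).1; lia
  apply Continuous.mul continuous_const
  apply Continuous.const_cpow (by fun_prop)
  left; exact_mod_cast this

theorem vor_ms_poly (S : Finset ℕ) (P : ℕ) (hP : P.primeFactors = S) (hP0 : P ≠ 0)
    (M : Finset ℕ) (c : ℕ → ℂ) (hM : ∀ m ∈ M, m ≠ 0 ∧ m.primeFactors ⊆ S) (hc : ∀ m, ‖c m‖ = 1)
    (σ1 ρ : ℝ) (hρ : ∀ N, ∑ n ∈ (Finset.Icc 2 N).filter (Nat.Coprime P), (n:ℝ) ^ (-(2 * σ1)) ≤ ρ)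
    (m0 : ℕ) (hm0 : ∀ m ∈ M, m ≤ m0)
    (N : ℕ) (T : ℝ) (hT : 0 ≤ T) (s0 : ℂ) (hs0 : σ1 ≤ s0.re) :
    ∫ t in T..(2 * T), ‖(∑ m ∈ M, c m * (m : ℂ) ^ (-(t * Complex.I))) * vP P N (s0 + t * Complex.I)‖ ^ 2
      ≤ (T + 4 * (m0 * N : ℕ) * (harmonic (m0 * N) : ℝ)) * (M.card * ρ) := by
  classical
  set I := M ×ˢ (Finset.Icc 2 N).filter (Nat.Coprime P) with hI
  have hmem : ∀ x ∈ I, (x.1 ∈ M ∧ x.1 ≠ 0 ∧ 2 ≤ x.2 ∧ x.2 ≤ N ∧ Nat.Coprime P x.2) := by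
    intro x hx
    simp only [hI, Finset.mem_product, Finset.mem_filter, Finset.mem_Icc] at hx
    exact ⟨hx.1, (hM _ hx.1).1, hx.2.1.1, hx.2.1.2, hx.2.2⟩
  have hinj : Set.InjOn (fun x : ℕ × ℕ => x.1 * x.2) I := by
    rintro ⟨m, n⟩ hx ⟨m', n'⟩ hx' h
    have a1 := hmem _ hx
    have a2 := hmem _ hx'
    simp only at h a1 a2
    have c1 : Nat.Coprime m n' := vor_coprime S P hP hP0 m n' a1.2.1 (hM m a1.1).2 a2.2.2.2.2
    have c2 : Nat.Coprime m' n := vor_coprime S P hP hP0 m' n a2.2.1 (hM m' a2.1).2 a1.2.2.2.2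
    have d1 : m ∣ m' := c1.dvd_of_dvd_mul_right (h ▸ Dvd.intro n rfl)
    have d2 : m' ∣ m := c2.dvd_of_dvd_mul_right (h ▸ Dvd.intro n' rfl)
    have e := Nat.dvd_antisymm d1 d2
    subst e
    have := Nat.eq_of_mul_eq_mul_left (Nat.pos_of_ne_zero a1.2.1) h
    rw [this]
  have hmv := vor_mv I (fun x : ℕ × ℕ => x.1 * x.2) hinj (m0 * N)
    (fun x hx => by
      have := hmem x hx
      exact Nat.mul_pos (Nat.pos_of_ne_zero this.2.1) (by lia))
    (fun x hx => by
      have := hmem x hx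
      exact Nat.mul_le_mul (hm0 _ this.1) this.2.2.2.1)
    (fun x => c x.1 * (x.2 : ℂ) ^ (-s0)) T (2 * T)
  have hfun : ∀ t : ℝ, (∑ m ∈ M, c m * (m : ℂ) ^ (-(t * Complex.I))) * vP P N (s0 + t * Complex.I)
      = ∑ x ∈ I, (c x.1 * (x.2 : ℂ) ^ (-s0)) * ((x.1 * x.2 : ℕ) : ℂ) ^ (-(t * Complex.I)) := by
    intro t
    have : vP P N (s0 + t * Complex.I) = ∑ n ∈ (Finset.Icc 2 N).filter (Nat.Coprime P), (n : ℂ) ^ (-(s0 + t * Complex.I)) := by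
      unfold vP vf
      rw [Finset.sum_filter]
      apply Finset.sum_congr rfl; intro n _
      split_ifs <;> simp
    rw [this, hI, Finset.sum_product, Finset.sum_mul_sum]
    apply Finset.sum_congr rfl; intro m hm
    apply Finset.sum_congr rfl; intro n hn
    simp only
    have hn0 : (n:ℂ) ≠ 0 := by
      have := (Finset.mem_Icc.1 (Finset.mem_filter.1 hn).1).1
      exact_mod_cast (by lia : n ≠ 0)
    rw [Nat.cast_mul, Complex.natCast_mul_natCast_cpow, neg_add, Complex.cpow_add _ _ hn0]
    ring
  have hsum : ∑ x ∈ I, ‖c x.1 * (x.2 : ℂ) ^ (-s0)‖ ^ 2 ≤ M.card * ρ := by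
    rw [hI, Finset.sum_product]
    have : ∀ m ∈ M, ∑ n ∈ (Finset.Icc 2 N).filter (Nat.Coprime P), ‖c m * (n : ℂ) ^ (-s0)‖ ^ 2 ≤ ρ := by
      intro m _
      refine le_trans (Finset.sum_le_sum ?_) (hρ N)
      intro n hn
      have := (Finset.mem_Icc.1 (Finset.mem_filter.1 hn).1).1
      rw [norm_mul, hc, one_mul, Complex.norm_natCast_cpow_of_pos (by lia), ← Real.rpow_natCast, ← Real.rpow_mul (by positivity)]
      apply Real.rpow_le_rpow_of_exponent_le (by exact_mod_cast (by lia : 1 ≤ n))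
      simp; linarith
    calc _ ≤ ∑ m ∈ M, ρ := Finset.sum_le_sum this
      _ = _ := by simp
  simp_rw [hfun]
  have h5 := (abs_le.1 hmv).2
  have hh : (0:ℝ) ≤ (harmonic (m0 * N) : ℝ) := by
    rw [harmonic_eq_sum_Icc]; push_cast; positivity
  have h0 : 0 ≤ T + 4 * (m0 * N : ℕ) * (harmonic (m0 * N) : ℝ) := by positivity
  have := mul_le_mul_of_nonneg_left hsum h0
  nlinarith

open MeasureTheory in
theorem vor_ms_rem (P : ℕ) (hP0 : P ≠ 0) (σ1 : ℝ) (h1 : 1 / 2 ≤ σ1) (N : ℕ) (hN : 1 ≤ N) (T : ℝ)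
    (hNT : N ≤ T) (hT : 8 ≤ T) (s0 : ℂ) (hs0 : σ1 ≤ s0.re) (hs0' : s0.re ≤ 2) (hs0i : |s0.im| ≤ 1) :
    ∫ t in T..(2 * T), ‖vL P (s0 + t * Complex.I) - 1 - vP P N (s0 + t * Complex.I)‖ ^ 2 ≤
      3 * (4 + 33 * Real.pi * (2 * P + 1) ^ 2) * T ^ 2 * (N : ℝ) ^ (-(2 * σ1)) := by
  set C : ℝ := 2 * P + 1 with hC
  have hC0 : 0 ≤ C := by positivity
  set D := mellin (Set.indicator (Set.Ioi (N : ℝ)) (vD P)) with hD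
  have hN' : (1:ℝ) ≤ N := by exact_mod_cast hN
  have hN0 : (0:ℝ) < N := by linarith
  have him := abs_le.1 hs0i
  set q : ℝ := (N : ℝ) ^ (-(2 * σ1)) with hq
  have hq0 : 0 ≤ q := by positivity
  have hre0 : 0 < s0.re := by linarith
  obtain ⟨hi, hm⟩ := vor_mellin_ms (vD P) (vD_measurable P) C (vD_bound P (Nat.pos_of_ne_zero hP0)) N hN' s0.re hre0
  have hshift : ∀ t : ℝ, (s0 + t * Complex.I) = (s0.re + ((t + s0.im : ℝ) : ℂ) * Complex.I) := by
    intro t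
    apply Complex.ext <;> simp [add_comm]
  have hi' : Integrable (fun t : ℝ => ‖D (-(s0 + t * Complex.I))‖ ^ 2) := by
    have := hi.comp_add_right s0.im
    simp_rw [hshift]; exact this
  have hm' : ∫ t : ℝ, ‖D (-(s0 + t * Complex.I))‖ ^ 2 ≤ 2 * Real.pi * (C ^ 2 * q) := by
    simp_rw [hshift]
    rw [integral_add_right_eq_self (fun t : ℝ => ‖D (-(s0.re + t * Complex.I))‖ ^ 2) s0.im]
    refine hm.trans ?_
    gcongr
    calc C ^ 2 * (N:ℝ) ^ (-(2 * s0.re)) / (2 * s0.re) ≤ C ^ 2 * (N:ℝ) ^ (-(2 * s0.re)) :=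
          div_le_self (by positivity) (by linarith)
      _ ≤ C ^ 2 * q := by
        rw [hq]
        gcongr
  have hpt : ∀ t ∈ Set.Icc T (2 * T), ‖vL P (s0 + t * Complex.I) - 1 - vP P N (s0 + t * Complex.I)‖ ^ 2
      ≤ 3 * (4 * q + C ^ 2 * q + 16 * T ^ 2 * ‖D (-(s0 + t * Complex.I))‖ ^ 2) := by
    intro t ht
    set s := s0 + t * Complex.I with hs
    have hsre : s.re = s0.re := by simp [hs]
    have hsim : s.im = s0.im + t := by simp [hs]
    have him0 : 0 < s.im := by rw [hsim]; linarith [ht.1]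
    have hr := vor_repr P (Nat.pos_of_ne_zero hP0) N hN s (by rw [hsre]; exact hre0) him0
    have hs1 : ∑ n ∈ Finset.Icc 1 N, vf P n * (n : ℂ) ^ (-s) = 1 + vP P N s := by
      rw [← Finset.add_sum_Ioc_eq_sum_Icc hN]
      congr 1
      · simp [vf]
    rw [hr, hs1]
    have e : 1 + vP P N s + (Nat.totient P / P : ℂ) * (N : ℂ) ^ (1 - s) / (s - 1) - vD P N * (N : ℂ) ^ (-s)
      + s * D (-s) - 1 - vP P N s = (Nat.totient P / P : ℂ) * (N : ℂ) ^ (1 - s) / (s - 1) + (- (vD P N * (N : ℂ) ^ (-s))) + s * D (-s) := by ring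
    rw [e]
    have h3 : ∀ a b c : ℂ, ‖a + b + c‖ ^ 2 ≤ 3 * (‖a‖ ^ 2 + ‖b‖ ^ 2 + ‖c‖ ^ 2) := by
      intro a b c
      have := norm_add₃_le (a := a) (b := b) (c := c)
      have h0 := norm_nonneg (a + b + c)
      nlinarith [sq_nonneg (‖a‖ - ‖b‖), sq_nonneg (‖a‖ - ‖c‖), sq_nonneg (‖b‖ - ‖c‖), norm_nonneg a, norm_nonneg b, norm_nonneg c]
    refine (h3 _ _ _).trans ?_
    have hNs : ‖(N:ℂ) ^ (-s)‖ ^ 2 ≤ q := by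
      rw [Complex.norm_natCast_cpow_of_pos (by lia), ← Real.rpow_natCast, ← Real.rpow_mul (by positivity), hq]
      apply Real.rpow_le_rpow_of_exponent_le hN'
      simp [hsre]; linarith
    have hal : ‖(Nat.totient P / P : ℂ)‖ ≤ 1 := by
      rw [norm_div, Complex.norm_natCast, Complex.norm_natCast]
      apply div_le_one_of_le₀ _ (by positivity)
      exact_mod_cast Nat.totient_le P
    have hs1n : T / 2 ≤ ‖s - 1‖ := by
      calc T / 2 ≤ |(s - 1).im| := by
            rw [abs_of_nonneg] <;> simp [hsim] <;> linarith [ht.1]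
        _ ≤ _ := Complex.abs_im_le_norm _
    have hsn : ‖s‖ ≤ 4 * T := by
      calc ‖s‖ ≤ |s.re| + |s.im| := Complex.norm_le_abs_re_add_abs_im s
        _ ≤ 4 * T := by
          rw [hsre, abs_of_pos hre0, abs_of_pos him0, hsim]; linarith [ht.2]
    have b1 : ‖(Nat.totient P / P : ℂ) * (N : ℂ) ^ (1 - s) / (s - 1)‖ ≤ 2 * ‖(N:ℂ) ^ (-s)‖ := by
      rw [sub_eq_add_neg, Complex.cpow_add _ _ (by exact_mod_cast hN0.ne'), Complex.cpow_one, norm_div, norm_mul, norm_mul, Complex.norm_natCast,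
        div_le_iff₀ (by linarith)]
      have h4 : ‖(Nat.totient P / P : ℂ)‖ * (N * ‖(N:ℂ) ^ (-s)‖) ≤ 1 * (N * ‖(N:ℂ) ^ (-s)‖) := by gcongr
      have h5 : (N:ℝ) ≤ 2 * ‖s - 1‖ := by linarith
      nlinarith [norm_nonneg ((N:ℂ) ^ (-s))]
    have b2 : ‖-(vD P N * (N : ℂ) ^ (-s))‖ ≤ C * ‖(N:ℂ) ^ (-s)‖ := by
      rw [norm_neg, norm_mul]; gcongr
      exact vD_bound P (Nat.pos_of_ne_zero hP0) N
    have b3 : ‖s * D (-s)‖ ≤ 4 * T * ‖D (-s)‖ := by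
      rw [norm_mul]; gcongr
    have c1 : ‖(Nat.totient P / P : ℂ) * (N : ℂ) ^ (1 - s) / (s - 1)‖ ^ 2 ≤ 4 * q := by
      calc _ ≤ (2 * ‖(N:ℂ) ^ (-s)‖) ^ 2 := by gcongr
        _ ≤ _ := by rw [mul_pow]; linarith
    have c2 : ‖-(vD P N * (N : ℂ) ^ (-s))‖ ^ 2 ≤ C ^ 2 * q := by
      calc _ ≤ (C * ‖(N:ℂ) ^ (-s)‖) ^ 2 := by gcongr
        _ ≤ _ := by rw [mul_pow]; gcongr
    have c3 : ‖s * D (-s)‖ ^ 2 ≤ 16 * T ^ 2 * ‖D (-s)‖ ^ 2 := by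
      calc _ ≤ (4 * T * ‖D (-s)‖) ^ 2 := by gcongr
        _ = _ := by ring
    linarith
  have hintg : IntervalIntegrable (fun t : ℝ => 3 * (4 * q + C ^ 2 * q + 16 * T ^ 2 * ‖D (-(s0 + t * Complex.I))‖ ^ 2)) volume T (2 * T) := by
    apply IntervalIntegrable.const_mul
    apply IntervalIntegrable.add (by simp)
    exact (hi'.intervalIntegrable).const_mul _
  have hcont : ContinuousOn (fun t : ℝ => ‖vL P (s0 + t * Complex.I) - 1 - vP P N (s0 + t * Complex.I)‖ ^ 2) (Set.uIcc T (2 * T)) := by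
    rw [Set.uIcc_of_le (by linarith)]
    apply ContinuousOn.pow
    apply ContinuousOn.norm
    apply ContinuousOn.sub _ (vP_cont P N s0).continuousOn
    apply ContinuousOn.sub _ continuousOn_const
    intro t ht
    apply ContinuousAt.continuousWithinAt
    have hne : s0 + t * Complex.I ≠ 1 := by
      intro h
      have := congrArg Complex.im h
      simp at this
      linarith [ht.1]
    exact ContinuousAt.comp (f := fun t : ℝ => s0 + t * Complex.I) (vL_differentiableAt P _ hne).continuousAt (by fun_prop)
  calc _ ≤ ∫ t in T..(2 * T), 3 * (4 * q + C ^ 2 * q + 16 * T ^ 2 * ‖D (-(s0 + t * Complex.I))‖ ^ 2) :=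
        intervalIntegral.integral_mono_on (by linarith) hcont.intervalIntegrable hintg hpt
    _ = 3 * (T * (4 * q + C ^ 2 * q) + 16 * T ^ 2 * ∫ t in T..(2 * T), ‖D (-(s0 + t * Complex.I))‖ ^ 2) := by
        rw [intervalIntegral.integral_const_mul, intervalIntegral.integral_add (by simp) ((hi'.intervalIntegrable).const_mul _),
          intervalIntegral.integral_const_mul, intervalIntegral.integral_const]
        simp only [smul_eq_mul]; ring
    _ ≤ 3 * (T * (4 * q + C ^ 2 * q) + 16 * T ^ 2 * (2 * Real.pi * (C ^ 2 * q))) := by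
        gcongr
        refine le_trans ?_ hm'
        rw [intervalIntegral.integral_of_le (by linarith)]
        exact setIntegral_le_integral hi' (Filter.Eventually.of_forall (fun t => by positivity))
    _ ≤ _ := by
        have hT1 : T ≤ T ^ 2 := by nlinarith
        have hpi : 1 ≤ Real.pi := by linarith [Real.pi_gt_three]
        have k1 : T * (4 * q + C ^ 2 * q) ≤ T ^ 2 * (4 * q + Real.pi * C ^ 2 * q) := by
          gcongr
          nlinarith [sq_nonneg C]
        nlinarith


open Filter Topology in
theorem vor_lim1 (m0 : ℕ) (κ : ℝ) (hκ : 1 < κ) :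
    Tendsto (fun N : ℕ => ((m0 * N : ℕ) : ℝ) * (harmonic (m0 * N) : ℝ) / (N : ℝ) ^ κ) atTop (𝓝 0) := by
  rcases Nat.eq_zero_or_pos m0 with h | hm0
  · simp [h]
  set ε := (κ - 1) / 2 with hε
  have hε0 : 0 < ε := by rw [hε]; linarith
  have h1 : Tendsto (fun x : ℝ => (1 + Real.log x) / x ^ ε) atTop (𝓝 0) := by
    have a := (isLittleO_log_rpow_atTop hε0).tendsto_div_nhds_zero
    have b := (tendsto_rpow_neg_atTop hε0)
    have := b.add a
    rw [add_zero] at this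
    refine this.congr' ?_
    filter_upwards [eventually_gt_atTop 0] with x hx
    rw [Real.rpow_neg hx.le, add_div, one_div]
  have h2 : Tendsto (fun N : ℕ => ((m0 * N : ℕ) : ℝ)) atTop atTop := by
    apply tendsto_natCast_atTop_atTop.comp
    exact tendsto_id.const_mul_atTop' hm0
  have h3 := (h1.comp h2).const_mul ((m0:ℝ) ^ (1 + ε))
  rw [mul_zero] at h3
  refine squeeze_zero' ?_ ?_ h3
  · filter_upwards with N
    have hh : (0:ℝ) ≤ (harmonic (m0 * N) : ℝ) := by
      rw [harmonic_eq_sum_Icc]; push_cast; positivity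
    positivity
  · filter_upwards [eventually_ge_atTop 1] with N hN
    have hN' : (1:ℝ) ≤ N := by exact_mod_cast hN
    have hm' : (1:ℝ) ≤ m0 := by exact_mod_cast hm0
    simp only [Function.comp]
    have hb := harmonic_le_one_add_log (m0 * N)
    have hlog : 0 ≤ Real.log ((m0 * N : ℕ) : ℝ) := Real.log_natCast_nonneg _
    have e : (m0:ℝ) ^ (1 + ε) * ((1 + Real.log ((m0 * N : ℕ) : ℝ)) / ((m0 * N : ℕ) : ℝ) ^ ε)
        = ((m0 * N : ℕ) : ℝ) * (1 + Real.log ((m0 * N : ℕ) : ℝ)) / (N:ℝ) ^ (1 + ε) := by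
      push_cast
      rw [Real.mul_rpow (by positivity) (by positivity), Real.rpow_add (by positivity), Real.rpow_add (by positivity), Real.rpow_one, Real.rpow_one]
      field_simp
    rw [e]
    have h5 : (N:ℝ) ^ (1 + ε) ≤ (N:ℝ) ^ κ := Real.rpow_le_rpow_of_exponent_le hN' (by rw [hε]; linarith)
    gcongr

open Filter Topology in
theorem vor_ms (S : Finset ℕ) (hS : ∀ p ∈ S, p.Prime) (P : ℕ) (hP : P.primeFactors = S) (hP0 : P ≠ 0)
    (ω : ℕ → ℂ) (hω : ∀ p, ‖ω p‖ = 1) (J : ℕ) (σ1 ρ : ℝ) (hσ1 : 1 / 2 < σ1)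
    (hρ : ∀ N, ∑ n ∈ (Finset.Icc 2 N).filter (Nat.Coprime P), (n:ℝ) ^ (-(2 * σ1)) ≤ ρ)
    (η : ℝ) (hη : 0 < η) :
    ∀ᶠ N : ℕ in atTop, ∀ s0 : ℂ, σ1 ≤ s0.re → s0.re ≤ 2 → |s0.im| ≤ 1 →
      ∫ t in ((N:ℝ) ^ (1 / 2 + σ1))..(2 * (N:ℝ) ^ (1 / 2 + σ1)), ‖vQ S ω J t‖ ^ 2 * ‖vL P (s0 + t * Complex.I) - 1‖ ^ 2
        ≤ (N:ℝ) ^ (1 / 2 + σ1) * (2 * J ^ S.card * ρ + η) := by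
  obtain ⟨M, c, hM1, hM2, hc, hQ⟩ := vQ_expand S hS ω hω J
  set κ := 1 / 2 + σ1 with hκ
  have hκ1 : 1 < κ := by rw [hκ]; linarith
  have hρ0 : 0 ≤ ρ := by simpa using hρ 0
  set m0 := M.sup id with hm0
  set K := 3 * (4 + 33 * Real.pi * (2 * (P:ℝ) + 1) ^ 2) with hK
  have l1 := (vor_lim1 m0 κ hκ1).const_mul (8 * (J ^ S.card * ρ))
  have l2 : Tendsto (fun N : ℕ => (2 * ((J:ℝ) ^ S.card) ^ 2 * K) * (N:ℝ) ^ (-(σ1 - 1 / 2))) atTop (𝓝 ((2 * ((J:ℝ) ^ S.card) ^ 2 * K) * 0)) :=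
    ((tendsto_rpow_neg_atTop (by linarith : 0 < σ1 - 1 / 2)).comp tendsto_natCast_atTop_atTop).const_mul _
  have l3 := l1.add l2
  simp only [mul_zero, add_zero] at l3
  filter_upwards [l3.eventually (gt_mem_nhds hη), eventually_ge_atTop 8] with N hN1 hN8 s0 hs0 hs0' hs0i
  have hN8' : (8:ℝ) ≤ N := by exact_mod_cast hN8
  have hN0 : (0:ℝ) < N := by linarith
  set T := (N:ℝ) ^ κ with hT
  have hNT : N ≤ T := by
    calc (N:ℝ) = (N:ℝ) ^ (1:ℝ) := by simp
      _ ≤ _ := Real.rpow_le_rpow_of_exponent_le (by linarith) hκ1.le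
  have hT0 : 0 < T := by linarith
  have hrem := vor_ms_rem P hP0 σ1 hσ1.le N (by lia) T hNT (by linarith) s0 hs0 hs0' hs0i
  have hpoly := vor_ms_poly S P hP hP0 M c hM2 hc σ1 ρ hρ m0 (fun m hm => Finset.le_sup (f := id) hm) N T hT0.le s0 hs0
  simp_rw [← hQ] at hpoly
  rw [hM1] at hpoly
  have him := abs_le.1 hs0i
  have hcL : ContinuousOn (fun t : ℝ => vL P (s0 + t * Complex.I)) (Set.Icc T (2 * T)) := by
    intro t ht
    apply ContinuousAt.continuousWithinAt
    have hne : s0 + t * Complex.I ≠ 1 := by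
      intro h
      have := congrArg Complex.im h
      simp at this
      linarith [ht.1]
    exact ContinuousAt.comp (f := fun t : ℝ => s0 + t * Complex.I) (vL_differentiableAt P _ hne).continuousAt (by fun_prop)
  have hcQ := (vQ_cont S hS ω J).continuousOn (s := Set.Icc T (2 * T))
  have hcP := (vP_cont P N s0).continuousOn (s := Set.Icc T (2 * T))
  have huI : Set.uIcc T (2 * T) = Set.Icc T (2 * T) := Set.uIcc_of_le (by linarith)
  have i1 : IntervalIntegrable (fun t => ‖vQ S ω J t‖ ^ 2 * ‖vL P (s0 + t * Complex.I) - 1‖ ^ 2) MeasureTheory.volume T (2 * T) := by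
    apply ContinuousOn.intervalIntegrable; rw [huI]; fun_prop
  have i2 : IntervalIntegrable (fun t => ‖vQ S ω J t * vP P N (s0 + t * Complex.I)‖ ^ 2) MeasureTheory.volume T (2 * T) := by
    apply ContinuousOn.intervalIntegrable; rw [huI]; fun_prop
  have i3 : IntervalIntegrable (fun t : ℝ => ‖vL P (s0 + t * Complex.I) - 1 - vP P N (s0 + t * Complex.I)‖ ^ 2) MeasureTheory.volume T (2 * T) := by
    apply ContinuousOn.intervalIntegrable; rw [huI]; fun_prop
  have hle : ∀ t ∈ Set.Icc T (2 * T), ‖vQ S ω J t‖ ^ 2 * ‖vL P (s0 + t * Complex.I) - 1‖ ^ 2 ≤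
      2 * ‖vQ S ω J t * vP P N (s0 + t * Complex.I)‖ ^ 2
      + 2 * ((J:ℝ) ^ S.card) ^ 2 * ‖vL P (s0 + t * Complex.I) - 1 - vP P N (s0 + t * Complex.I)‖ ^ 2 := by
    intro t _
    set l := vL P (s0 + t * Complex.I) - 1
    set u := vP P N (s0 + t * Complex.I)
    have h1 : ‖l‖ ^ 2 ≤ 2 * ‖u‖ ^ 2 + 2 * ‖l - u‖ ^ 2 := by
      have : ‖l‖ ≤ ‖u‖ + ‖l - u‖ := by
        calc ‖l‖ = ‖u + (l - u)‖ := by congr 1; ring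
          _ ≤ _ := norm_add_le _ _
      nlinarith [norm_nonneg l, sq_nonneg (‖u‖ - ‖l - u‖), norm_nonneg u, norm_nonneg (l - u)]
    have h2 := vQ_norm_le S hS ω hω J t
    calc _ ≤ ‖vQ S ω J t‖ ^ 2 * (2 * ‖u‖ ^ 2 + 2 * ‖l - u‖ ^ 2) := by gcongr
      _ = 2 * ‖vQ S ω J t * u‖ ^ 2 + 2 * ‖vQ S ω J t‖ ^ 2 * ‖l - u‖ ^ 2 := by rw [norm_mul]; ring
      _ ≤ _ := by gcongr
  have hmono := intervalIntegral.integral_mono_on (by linarith : T ≤ 2 * T) i1 ((i2.const_mul 2).add (i3.const_mul (2 * ((J:ℝ) ^ S.card) ^ 2))) hle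
  rw [intervalIntegral.integral_add (i2.const_mul 2) (i3.const_mul _), intervalIntegral.integral_const_mul, intervalIntegral.integral_const_mul] at hmono
  have hTq : T * (N:ℝ) ^ (-(2 * σ1)) = (N:ℝ) ^ (-(σ1 - 1 / 2)) := by
    rw [hT, ← Real.rpow_add hN0]; congr 1; rw [hκ]; ring
  set q := (N:ℝ) ^ (-(2 * σ1))
  rw [← hTq] at hN1
  have hT' := hT0.ne'
  set XH := ((m0 * N : ℕ) : ℝ) * (harmonic (m0 * N) : ℝ)
  have hfin : 8 * (J ^ S.card * ρ) * XH + 2 * ((J:ℝ) ^ S.card) ^ 2 * K * (T ^ 2 * q) ≤ T * η := by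
    have := mul_le_mul_of_nonneg_left hN1.le hT0.le
    calc _ = T * (8 * (J ^ S.card * ρ) * (XH / T) + 2 * ((J:ℝ) ^ S.card) ^ 2 * K * (T * q)) := by field_simp
      _ ≤ _ := this
  calc _ ≤ _ := hmono
    _ ≤ 2 * ((T + 4 * (m0 * N : ℕ) * (harmonic (m0 * N) : ℝ)) * ((J ^ S.card : ℕ) * ρ)) + 2 * ((J:ℝ) ^ S.card) ^ 2 * (K * T ^ 2 * q) := by
        gcongr
    _ = T * (2 * J ^ S.card * ρ) + (8 * (J ^ S.card * ρ) * XH + 2 * ((J:ℝ) ^ S.card) ^ 2 * K * (T ^ 2 * q)) := by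
        push_cast
        simp only [XH]; push_cast
        ring
    _ ≤ _ := by linarith

open Filter Topology in
theorem vor_ms_Q (S : Finset ℕ) (hS : ∀ p ∈ S, p.Prime) (ω : ℕ → ℂ) (hω : ∀ p, ‖ω p‖ = 1) (J : ℕ) :
    ∀ᶠ T : ℝ in atTop, |(∫ t in T..(2 * T), ‖vQ S ω J t‖ ^ 2) - T * J ^ S.card| ≤ T := by
  obtain ⟨M, c, hM1, hM2, hc, hQ⟩ := vQ_expand S hS ω hω J
  set m0 := M.sup id with hm0
  filter_upwards [eventually_ge_atTop (4 * m0 * (harmonic m0 : ℝ) * J ^ S.card)] with T hT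
  have := vor_mv M id Function.injective_id.injOn m0 (fun m hm => Nat.pos_of_ne_zero (hM2 m hm).1)
    (fun m hm => Finset.le_sup (f := id) hm) c T (2 * T)
  simp only [id, hc, ← hQ] at this
  simp only [one_pow, Finset.sum_const, hM1, nsmul_eq_mul, mul_one] at this
  push_cast at this
  rw [show 2 * T - T = T by ring] at this
  linarith


set_option maxHeartbeats 1600000 in
open Filter Topology MeasureTheory in
theorem vor_choose (S : Finset ℕ) (hSne : S.Nonempty) (hS : ∀ p ∈ S, p.Prime) (P : ℕ) (hP : P.primeFactors = S) (hP0 : P ≠ 0)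
    (ω : ℕ → ℂ) (hω : ∀ p, ‖ω p‖ = 1) (σ1 ρ : ℝ) (hσ1 : 1 / 2 < σ1)
    (hρ : ∀ N, ∑ n ∈ (Finset.Icc 2 N).filter (Nat.Coprime P), (n:ℝ) ^ (-(2 * σ1)) ≤ ρ)
    (σ r : ℝ) (hr : 0 < r) (hr1 : r ≤ 1) (h1 : σ1 ≤ σ - r) (h2 : σ + r ≤ 2)
    (η : ℝ) (hη : 0 < η) (hηρ : 8 * Real.pi * ρ ≤ η) (δ : ℝ) (hδ : 0 < δ) :
    ∃ t : ℝ, 8 ≤ t ∧ (∀ p ∈ S, ‖(p:ℂ) ^ (-(t * Complex.I)) - ω p‖ < δ) ∧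
      ∫ φ in (0:ℝ)..(2 * Real.pi), ‖vL P (circleMap σ r φ + t * Complex.I) - 1‖ ^ 2 < η := by
  classical
  have hpi := Real.pi_pos
  set k := S.card with hk
  have hk1 : 1 ≤ k := Finset.card_pos.2 hSne
  obtain ⟨J, hJ⟩ := exists_nat_ge (16 * k / δ ^ 2 + 10)
  have hre : ∀ φ, |(circleMap σ r φ).re - σ| ≤ r := by
    intro φ
    have := Complex.abs_re_le_norm (circleMap σ r φ - σ)
    simpa [circleMap, abs_of_pos hr] using this
  have him : ∀ φ, |(circleMap σ r φ).im| ≤ r := by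
    intro φ
    have := Complex.abs_im_le_norm (circleMap σ r φ - σ)
    simpa [circleMap, abs_of_pos hr] using this
  have hms := vor_ms S hS P hP hP0 ω hω J σ1 ρ hσ1 hρ (η / (2 * Real.pi)) (by positivity)
  have hTt : Tendsto (fun N : ℕ => (N:ℝ) ^ (1 / 2 + σ1)) atTop atTop :=
    (tendsto_rpow_atTop (by linarith)).comp tendsto_natCast_atTop_atTop
  have hQS := hTt.eventually (vor_ms_Q S hS ω hω J)
  have hQe : ∀ᶠ N : ℕ in atTop, ∀ p ∈ S, |(∫ t in ((N:ℝ) ^ (1 / 2 + σ1))..(2 * (N:ℝ) ^ (1 / 2 + σ1)), ‖vQ (S.erase p) ω J t‖ ^ 2)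
      - (N:ℝ) ^ (1 / 2 + σ1) * J ^ (S.erase p).card| ≤ (N:ℝ) ^ (1 / 2 + σ1) := by
    rw [Filter.eventually_all_finset]
    intro p hp
    exact hTt.eventually (vor_ms_Q (S.erase p) (fun q hq => hS q (Finset.mem_of_mem_erase hq)) ω hω J)
  obtain ⟨N, hN1, hN2, hN3, hN4⟩ := (hms.and (hQS.and (hQe.and (hTt.eventually (eventually_ge_atTop 8))))).exists
  set T := (N:ℝ) ^ (1 / 2 + σ1) with hT
  have hT0 : 0 < T := by linarith
  by_contra hcon
  push Not at hcon
  have hTT : T ≤ 2 * T := by linarith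
  set F : ℝ → ℝ → ℝ := fun t φ => ‖vQ S ω J t‖ ^ 2 * ‖vL P (circleMap σ r φ + t * Complex.I) - 1‖ ^ 2 with hF
  have hFc : ContinuousOn F.uncurry (Set.Icc T (2 * T) ×ˢ Set.Icc 0 (2 * Real.pi)) := by
    have c1 : Continuous (fun x : ℝ × ℝ => vQ S ω J x.1) := (vQ_cont S hS ω J).comp continuous_fst
    have c2 : ContinuousOn (fun x : ℝ × ℝ => vL P (circleMap σ r x.2 + x.1 * Complex.I)) (Set.Icc T (2 * T) ×ˢ Set.Icc 0 (2 * Real.pi)) := by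
      rintro ⟨t, φ⟩ hx
      apply ContinuousAt.continuousWithinAt
      have hne : circleMap σ r φ + t * Complex.I ≠ 1 := by
        intro h
        have := congrArg Complex.im h
        have h3 := abs_le.1 (him φ)
        have h4 := hx.1.1
        simp only [Complex.add_im, Complex.mul_I_im, Complex.ofReal_re, Complex.one_im] at this h4
        linarith
      have c3 : Continuous (circleMap (σ:ℂ) r) := continuous_circleMap _ _
      have c4 : Continuous (fun x : ℝ × ℝ => circleMap σ r x.2 + x.1 * Complex.I) := by fun_prop
      exact ContinuousAt.comp_of_eq (g := vL P) (vL_differentiableAt P _ hne).continuousAt c4.continuousAt rfl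
    have := c1.continuousOn (s := Set.Icc T (2 * T) ×ˢ Set.Icc 0 (2 * Real.pi))
    simp only [hF, Function.uncurry_def]
    fun_prop
  have hFi : IntegrableOn F.uncurry (Set.uIoc T (2 * T) ×ˢ Set.uIoc 0 (2 * Real.pi)) := by
    apply (hFc.integrableOn_compact (isCompact_Icc.prod isCompact_Icc)).mono_set
    rw [Set.uIoc_of_le hTT, Set.uIoc_of_le (by positivity)]
    exact Set.prod_mono Set.Ioc_subset_Icc_self Set.Ioc_subset_Icc_self
  have hsw := intervalIntegral_intervalIntegral_swap hFi
  have hHi : IntervalIntegrable (fun t => ∫ φ in (0:ℝ)..(2 * Real.pi), F t φ) volume T (2 * T) := by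
    rw [intervalIntegrable_iff]
    have h3 := hFi
    rw [IntegrableOn, Measure.volume_eq_prod, ← Measure.prod_restrict] at h3
    have h4 := h3.integral_prod_left
    rw [IntegrableOn]
    refine h4.congr (Eventually.of_forall fun t => ?_)
    simp only [Function.uncurry]
    rw [intervalIntegral.integral_of_le (by positivity), Set.uIoc_of_le (by positivity)]
  have hH : ∫ t in T..(2 * T), (∫ φ in (0:ℝ)..(2 * Real.pi), F t φ) ≤ 2 * Real.pi * (T * (2 * J ^ k * ρ + η / (2 * Real.pi))) := by
    rw [hsw]
    have hc := intervalIntegral.norm_integral_le_of_norm_le_const (a := 0) (b := 2 * Real.pi)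
      (f := fun φ => ∫ t in T..(2 * T), F t φ) (C := T * (2 * J ^ k * ρ + η / (2 * Real.pi))) (by
        intro φ _
        have h5 := abs_le.1 (hre φ)
        have h6 := hN1 (circleMap σ r φ) (by linarith) (by linarith) ((him φ).trans hr1)
        rw [Real.norm_of_nonneg]
        · exact h6
        · apply intervalIntegral.integral_nonneg hTT
          intro t _
          simp only [hF]; positivity)
    rw [sub_zero, abs_of_pos (by positivity)] at hc
    calc _ ≤ _ := Real.le_norm_self _
      _ ≤ _ := hc
      _ = _ := by ring
  have hpt : ∀ t ∈ Set.Icc T (2 * T), ‖vQ S ω J t‖ ^ 2 ≤ ∑ p ∈ S, (4 / δ ^ 2) * ‖vQ (S.erase p) ω J t‖ ^ 2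
      + (1 / η) * ∫ φ in (0:ℝ)..(2 * Real.pi), F t φ := by
    intro t ht
    have hFH : ∫ φ in (0:ℝ)..(2 * Real.pi), F t φ = ‖vQ S ω J t‖ ^ 2 * ∫ φ in (0:ℝ)..(2 * Real.pi), ‖vL P (circleMap σ r φ + t * Complex.I) - 1‖ ^ 2 := by
      simp only [hF]; rw [intervalIntegral.integral_const_mul]
    have hH0 : 0 ≤ ∫ φ in (0:ℝ)..(2 * Real.pi), F t φ := by
      apply intervalIntegral.integral_nonneg (by positivity)
      intro φ _; simp only [hF]; positivity
    by_cases hh : ∀ p ∈ S, ‖(p:ℂ) ^ (-(t * Complex.I)) - ω p‖ < δ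
    · have h7 := hcon t (by linarith [ht.1]) hh
      have h8 : ‖vQ S ω J t‖ ^ 2 ≤ (1 / η) * ∫ φ in (0:ℝ)..(2 * Real.pi), F t φ := by
        rw [hFH]
        rw [one_div, ← div_eq_inv_mul, le_div_iff₀ hη]
        gcongr
      have : 0 ≤ ∑ p ∈ S, (4 / δ ^ 2) * ‖vQ (S.erase p) ω J t‖ ^ 2 := by positivity
      linarith
    · push Not at hh
      obtain ⟨p, hp, hpd⟩ := hh
      have h8 : ‖vQ S ω J t‖ ^ 2 ≤ (4 / δ ^ 2) * ‖vQ (S.erase p) ω J t‖ ^ 2 := by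
        rw [div_mul_eq_mul_div, le_div_iff₀ (by positivity)]
        refine le_trans ?_ (vQ_erase S hS ω hω J t p hp)
        gcongr
      have h9 := Finset.single_le_sum (f := fun p => (4 / δ ^ 2) * ‖vQ (S.erase p) ω J t‖ ^ 2) (fun _ _ => by positivity) hp
      have : 0 ≤ (1 / η) * ∫ φ in (0:ℝ)..(2 * Real.pi), F t φ := by positivity
      linarith
  have iQ : ∀ S' ⊆ S, IntervalIntegrable (fun t => ‖vQ S' ω J t‖ ^ 2) volume T (2 * T) := by
    intro S' hS'
    apply Continuous.intervalIntegrable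
    have := vQ_cont S' (fun p hp => hS p (hS' hp)) ω J
    fun_prop
  have iE : ∀ p ∈ S, IntervalIntegrable (fun t => (4 / δ ^ 2) * ‖vQ (S.erase p) ω J t‖ ^ 2) volume T (2 * T) :=
    fun p _ => (iQ _ (Finset.erase_subset _ _)).const_mul _
  have iES : IntervalIntegrable (fun t => ∑ p ∈ S, (4 / δ ^ 2) * ‖vQ (S.erase p) ω J t‖ ^ 2) volume T (2 * T) := by
    have := IntervalIntegrable.sum S iE
    have e : (fun t => ∑ p ∈ S, (4 / δ ^ 2) * ‖vQ (S.erase p) ω J t‖ ^ 2) = ∑ p ∈ S, (fun t => (4 / δ ^ 2) * ‖vQ (S.erase p) ω J t‖ ^ 2) := by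
      ext t; simp
    rw [e]; exact this
  have hmono := intervalIntegral.integral_mono_on hTT (iQ S subset_rfl) (iES.add (hHi.const_mul (1 / η))) hpt
  rw [intervalIntegral.integral_add iES (hHi.const_mul _), intervalIntegral.integral_const_mul,
    intervalIntegral.integral_finsetSum iE] at hmono
  have hE : ∑ p ∈ S, ∫ t in T..(2 * T), (4 / δ ^ 2) * ‖vQ (S.erase p) ω J t‖ ^ 2 ≤ k * ((4 / δ ^ 2) * (T * J ^ (k - 1) + T)) := by
    rw [hk, ← nsmul_eq_mul, ← Finset.sum_const]
    apply Finset.sum_le_sum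
    intro p hp
    rw [intervalIntegral.integral_const_mul]
    gcongr
    have := (abs_le.1 (hN3 p hp)).2
    rw [Finset.card_erase_of_mem hp] at this
    linarith
  have hlow := (abs_le.1 hN2).1
  have hup : (1 / η) * ∫ t in T..(2 * T), (∫ φ in (0:ℝ)..(2 * Real.pi), F t φ) ≤ T * (J ^ k / 2 + 1) := by
    calc _ ≤ (1 / η) * (2 * Real.pi * (T * (2 * J ^ k * ρ + η / (2 * Real.pi)))) := by gcongr
      _ = T * ((8 * Real.pi * ρ) / η * (J ^ k / 2) + 1) := by field_simp; ring
      _ ≤ T * (1 * (J ^ k / 2) + 1) := by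
        gcongr
        exact div_le_one_of_le₀ hηρ hη.le
      _ = _ := by ring
  have hfin : T * ((J:ℝ) ^ k - 1) ≤ T * (k * ((4 / δ ^ 2) * (J ^ (k - 1) + 1)) + (J ^ k / 2 + 1)) := by
    linarith [hmono, hE, hlow, hup]
  have hfin2 := le_of_mul_le_mul_left hfin hT0
  have hJk : (J:ℝ) ^ k = J * J ^ (k - 1) := by
    rw [← pow_succ']; congr 1; lia
  have hJ1 : (1:ℝ) ≤ J := by
    have : 0 ≤ 16 * (k:ℝ) / δ ^ 2 := by positivity
    linarith
  have hJ2 : (1:ℝ) ≤ (J:ℝ) ^ (k - 1) := one_le_pow₀ hJ1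
  rw [hJk] at hfin2
  set x := (J:ℝ) ^ (k - 1)
  have hd : 16 * (k:ℝ) / δ ^ 2 = 4 * (k * (4 / δ ^ 2)) := by ring
  rw [hd] at hJ
  have hg : 0 ≤ (k:ℝ) * (4 / δ ^ 2) := by positivity
  rw [← mul_assoc] at hfin2
  set g := (k:ℝ) * (4 / δ ^ 2)
  nlinarith


open Metric in
theorem vor_cauchy (f : ℂ → ℂ) (c : ℂ) (R : ℝ) (hR : 0 < R) (hf : DiffContOnCl ℂ f (ball c R)) (ε : ℝ) (hε : 0 < ε)
    (hH : ∫ φ in (0:ℝ)..(2 * Real.pi), ‖f (circleMap c R φ)‖ ^ 2 ≤ ε ^ 2) (n : ℕ) :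
    ‖iteratedDeriv n f c‖ ≤ n.factorial / R ^ n * ε := by
  have hpi := Real.pi_pos
  have hpi3 := Real.pi_gt_three
  have h1 := DiffContOnCl.circleIntegral_one_div_sub_center_pow_smul hR n hf
  have hcl : ContinuousOn f (closedBall c R) := hf.continuousOn_ball
  have hc : Continuous (fun φ => f (circleMap c R φ)) :=
    hcl.comp_continuous (continuous_circleMap _ _) (fun φ => circleMap_mem_closedBall c hR.le φ)
  have hc2 : Continuous (fun φ => ‖f (circleMap c R φ)‖ ^ 2) := hc.norm.pow 2
  have h2 : ‖∮ z in C(c, R), (1 / (z - c) ^ (n + 1)) • f z‖ ≤ 1 / R ^ n * (2 * Real.pi * ε) := by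
    rw [circleIntegral]
    calc _ ≤ ∫ φ in (0:ℝ)..(2 * Real.pi), ‖deriv (circleMap c R) φ • (1 / (circleMap c R φ - c) ^ (n + 1)) • f (circleMap c R φ)‖ :=
          intervalIntegral.norm_integral_le_integral_norm (by positivity)
      _ = ∫ φ in (0:ℝ)..(2 * Real.pi), 1 / R ^ n * ‖f (circleMap c R φ)‖ := by
          apply intervalIntegral.integral_congr
          intro φ _
          simp only [norm_smul, deriv_circleMap, norm_div, norm_pow, norm_mul, norm_one, Complex.norm_I, circleMap_sub_center, norm_circleMap_zero, abs_of_pos hR]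
          field_simp
          ring
      _ ≤ ∫ φ in (0:ℝ)..(2 * Real.pi), 1 / R ^ n * (ε / 2 + (1 / (2 * ε)) * ‖f (circleMap c R φ)‖ ^ 2) := by
          apply intervalIntegral.integral_mono_on (by positivity)
          · exact (hc.norm.const_mul _).intervalIntegrable _ _
          · exact ((((hc.norm.pow 2).const_mul _).const_add _).const_mul _).intervalIntegrable _ _
          · intro φ _
            gcongr
            have : ε / 2 + (1 / (2 * ε)) * ‖f (circleMap c R φ)‖ ^ 2 = (ε ^ 2 + ‖f (circleMap c R φ)‖ ^ 2) / (2 * ε) := by field_simp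
            rw [this, le_div_iff₀ (by positivity)]
            nlinarith [sq_nonneg (ε - ‖f (circleMap c R φ)‖)]
      _ = 1 / R ^ n * (2 * Real.pi * (ε / 2) + (1 / (2 * ε)) * ∫ φ in (0:ℝ)..(2 * Real.pi), ‖f (circleMap c R φ)‖ ^ 2) := by
          rw [intervalIntegral.integral_const_mul, intervalIntegral.integral_add (by simp) ((hc2.const_mul _).intervalIntegrable _ _), intervalIntegral.integral_const_mul, intervalIntegral.integral_const, smul_eq_mul, sub_zero]
      _ ≤ 1 / R ^ n * (2 * Real.pi * (ε / 2) + (1 / (2 * ε)) * ε ^ 2) := by gcongr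
      _ ≤ _ := by
          gcongr
          have : 1 / (2 * ε) * ε ^ 2 = ε / 2 := by field_simp
          rw [this]; nlinarith
  rw [h1, norm_smul, norm_div, norm_mul, norm_mul] at h2
  simp only [Complex.norm_I, Complex.norm_natCast, Complex.norm_real, Real.norm_eq_abs, abs_of_pos hpi, Complex.norm_ofNat, mul_one] at h2
  have hn : (0:ℝ) < n.factorial := by exact_mod_cast n.factorial_pos
  have h3 : ‖iteratedDeriv n f c‖ = (2 * Real.pi / n.factorial * ‖iteratedDeriv n f c‖) * (n.factorial / (2 * Real.pi)) := by
    field_simp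
  rw [h3]
  calc _ ≤ (1 / R ^ n * (2 * Real.pi * ε)) * (n.factorial / (2 * Real.pi)) := by gcongr
    _ = _ := by field_simp

open Filter Topology in
theorem jc_mul {ι : Type*} {l : Filter ι} {F G : ι → ℂ → ℂ} {f g : ℂ → ℂ} {c : ℂ} {n : ℕ}
    (hF : ∀ i, AnalyticAt ℂ (F i) c) (hG : ∀ i, AnalyticAt ℂ (G i) c) (hf : AnalyticAt ℂ f c) (hg : AnalyticAt ℂ g c)
    (hFt : ∀ k < n, Tendsto (fun i => iteratedDeriv k (F i) c) l (𝓝 (iteratedDeriv k f c)))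
    (hGt : ∀ k < n, Tendsto (fun i => iteratedDeriv k (G i) c) l (𝓝 (iteratedDeriv k g c))) :
    ∀ k < n, Tendsto (fun i => iteratedDeriv k (fun z => F i z * G i z) c) l (𝓝 (iteratedDeriv k (fun z => f z * g z) c)) := by
  intro k hk
  simp_rw [fun i => iteratedDeriv_fun_mul (n := k) (hF i).contDiffAt (hG i).contDiffAt,
    iteratedDeriv_fun_mul (n := k) hf.contDiffAt hg.contDiffAt]
  apply tendsto_finsetSum
  intro j hj
  have := Finset.mem_range.1 hj
  exact ((hFt j (by lia)).const_mul _).mul (hGt (k - j) (by lia))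

open Filter Topology in
theorem jc_prod {ι α : Type*} {l : Filter ι} {c : ℂ} {n : ℕ} (S : Finset α) (F : α → ι → ℂ → ℂ) (f : α → ℂ → ℂ)
    (hF : ∀ p ∈ S, ∀ i, AnalyticAt ℂ (F p i) c) (hf : ∀ p ∈ S, AnalyticAt ℂ (f p) c)
    (hFt : ∀ p ∈ S, ∀ k < n, Tendsto (fun i => iteratedDeriv k (F p i) c) l (𝓝 (iteratedDeriv k (f p) c))) :
    ∀ k < n, Tendsto (fun i => iteratedDeriv k (fun z => ∏ p ∈ S, F p i z) c) l (𝓝 (iteratedDeriv k (fun z => ∏ p ∈ S, f p z) c)) := by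
  classical
  induction S using Finset.induction_on with
  | empty => intro k _; simp only [Finset.prod_empty]; exact tendsto_const_nhds
  | insert p S hp ih =>
    simp_rw [Finset.prod_insert hp]
    apply jc_mul
    · exact fun i => hF p (Finset.mem_insert_self _ _) i
    · exact fun i => Finset.analyticAt_fun_prod _ (fun q hq => hF q (Finset.mem_insert_of_mem hq) i)
    · exact hf p (Finset.mem_insert_self _ _)
    · exact Finset.analyticAt_fun_prod _ (fun q hq => hf q (Finset.mem_insert_of_mem hq))
    · exact hFt p (Finset.mem_insert_self _ _)
    · exact ih (fun q hq => hF q (Finset.mem_insert_of_mem hq)) (fun q hq => hf q (Finset.mem_insert_of_mem hq))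
        (fun q hq => hFt q (Finset.mem_insert_of_mem hq))

theorem jc_exp_succ {f : ℂ → ℂ} {c : ℂ} (hf : AnalyticAt ℂ f c) (k : ℕ) :
    iteratedDeriv (k + 1) (fun z => Complex.exp (f z)) c =
      ∑ i ∈ Finset.range (k + 1), (k.choose i : ℂ) * iteratedDeriv (i + 1) f c * iteratedDeriv (k - i) (fun z => Complex.exp (f z)) c := by
  rw [iteratedDeriv_succ']
  have h1 : deriv (fun z => Complex.exp (f z)) =ᶠ[nhds c] fun z => deriv f z * Complex.exp (f z) := by
    filter_upwards [hf.eventually_analyticAt] with z hz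
    rw [deriv_cexp hz.differentiableAt, mul_comm]
  rw [h1.iteratedDeriv_eq, iteratedDeriv_fun_mul (n := k) hf.deriv.contDiffAt hf.cexp'.contDiffAt]
  simp_rw [iteratedDeriv_succ']

open Filter Topology in
theorem jc_exp {ι : Type*} {l : Filter ι} {F : ι → ℂ → ℂ} {f : ℂ → ℂ} {c : ℂ} {n : ℕ}
    (hF : ∀ i, AnalyticAt ℂ (F i) c) (hf : AnalyticAt ℂ f c)
    (hFt : ∀ k < n, Tendsto (fun i => iteratedDeriv k (F i) c) l (𝓝 (iteratedDeriv k f c))) :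
    ∀ k < n, Tendsto (fun i => iteratedDeriv k (fun z => Complex.exp (F i z)) c) l (𝓝 (iteratedDeriv k (fun z => Complex.exp (f z)) c)) := by
  intro k
  induction k using Nat.strong_induction_on with
  | _ k ih =>
    intro hk
    rcases k with _ | k
    · simp only [iteratedDeriv_zero]
      have := hFt 0 hk
      simp only [iteratedDeriv_zero] at this
      exact (Complex.continuous_exp.tendsto _).comp this
    · rw [jc_exp_succ hf]
      simp_rw [fun i => jc_exp_succ (hF i)]
      apply tendsto_finsetSum
      intro j hj
      have := Finset.mem_range.1 hj
      exact ((hFt (j + 1) (by lia)).const_mul _).mul (ih (k - j) (by lia) (by lia))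


theorem vor_midpoint (c : ℂ) (hc : ‖c‖ ≤ 1) :
    ∃ d : ℂ, ‖d‖ ≤ 1 ∧ ‖c + d‖ = 1 ∧ ‖c - d‖ = 1 := by
  obtain ⟨z, hz, hcz⟩ : ∃ z : ℂ, ‖z‖ = 1 ∧ c = z * ‖c‖ := by
    by_cases h : c = 0
    · exact ⟨1, by simp, by simp [h]⟩
    · have h' : (‖c‖ : ℂ) ≠ 0 := by simpa using h
      exact ⟨c / ‖c‖, by rw [norm_div]; simp [h], by field_simp⟩
  set y := Real.sqrt (1 - ‖c‖ ^ 2) with hy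
  have hy2 : y ^ 2 = 1 - ‖c‖ ^ 2 := Real.sq_sqrt (by nlinarith [norm_nonneg c])
  have hy0 : 0 ≤ y := Real.sqrt_nonneg _
  have hn : ∀ a b : ℝ, a ^ 2 + b ^ 2 = 1 → ‖(a + b * Complex.I : ℂ)‖ = 1 := by
    intro a b h
    rw [Complex.norm_add_mul_I, h, Real.sqrt_one]
  refine ⟨z * (y * Complex.I), ?_, ?_, ?_⟩
  · rw [norm_mul, hz]; simp [abs_of_nonneg hy0]; nlinarith [sq_nonneg ‖c‖]
  · conv_lhs => rw [hcz]
    rw [← mul_add, norm_mul, hz, hn _ _ (by rw [hy2]; ring), one_mul]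
  · conv_lhs => rw [hcz]
    rw [← mul_sub, norm_mul, hz]
    have := hn ‖c‖ (-y) (by rw [neg_sq, hy2]; ring)
    rw [one_mul, ← this]; congr 1; push_cast; ring

theorem vor_round {E : Type*} [NormedAddCommGroup E] [InnerProductSpace ℂ E] (u : ℕ → E) (c : ℕ → ℂ)
    (hc : ∀ m, ‖c m‖ ≤ 1) (s : Finset ℕ) :
    ∃ ω : ℕ → ℂ, (∀ m, ‖ω m‖ = 1) ∧ ‖∑ m ∈ s, (ω m - c m) • u m‖ ^ 2 ≤ ∑ m ∈ s, ‖u m‖ ^ 2 := by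
  classical
  induction s using Finset.induction_on with
  | empty => exact ⟨fun _ => 1, by simp, by simp⟩
  | insert p s hp ih =>
    obtain ⟨ω, hω, hle⟩ := ih
    obtain ⟨d, hd, h1, h2⟩ := vor_midpoint (c p) (hc p)
    set e := ∑ m ∈ s, (ω m - c m) • u m with he
    have hsum : ∀ w : ℂ, ∑ m ∈ insert p s, (Function.update ω p w m - c m) • u m = (w - c p) • u p + e := by
      intro w
      rw [Finset.sum_insert hp, Function.update_self, he]
      congr 1
      apply Finset.sum_congr rfl
      intro m hm
      have hne : m ≠ p := by
        rintro rfl; exact hp hm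
      rw [Function.update_of_ne hne]
    have hun : ∀ w : ℂ, ‖w‖ = 1 → ∀ m, ‖Function.update ω p w m‖ = 1 := by
      intro w hw m
      by_cases h : m = p
      · subst h; rw [Function.update_self, hw]
      · rw [Function.update_of_ne h, hω]
    have hpar := parallelogram_law_with_norm ℂ e (d • u p)
    have hdu : ‖d • u p‖ ^ 2 ≤ ‖u p‖ ^ 2 := by
      rw [norm_smul]
      have := mul_le_mul_of_nonneg_right hd (norm_nonneg (u p))
      rw [one_mul] at this
      gcongr
    rw [Finset.sum_insert hp]
    rcases le_total ‖e + d • u p‖ ‖e - d • u p‖ with h | h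
    · refine ⟨Function.update ω p (c p + d), hun _ h1, ?_⟩
      rw [hsum, add_sub_cancel_left, add_comm]
      nlinarith [norm_nonneg (e + d • u p)]
    · refine ⟨Function.update ω p (c p - d), hun _ h2, ?_⟩
      rw [hsum, show c p - d - c p = -d by ring, neg_smul, neg_add_eq_sub]
      nlinarith [norm_nonneg (e - d • u p)]

theorem vor_dense {E : Type*} [NormedAddCommGroup E] [InnerProductSpace ℂ E] (u : ℕ → E)
    (hu : ∀ f : StrongDual ℂ E, f ≠ 0 → ¬ Summable (fun m => ‖f (u m)‖)) (M : ℕ) (v : E) (ε : ℝ) (hε : 0 < ε) :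
    ∃ (N : ℕ) (c : ℕ → ℂ), M ≤ N ∧ (∀ m, ‖c m‖ ≤ 1) ∧ ‖∑ m ∈ Finset.Ico M N, c m • u m - v‖ < ε := by
  classical
  set K0 : Set (ℕ →₀ ℂ) := {c | ∀ m, ‖c m‖ ≤ 1 ∧ (m < M → c m = 0)} with hK0
  have hK0c : Convex ℝ K0 := by
    intro x hx y hy a b ha hb hab m
    refine ⟨?_, ?_⟩
    · have h1 := (hx m).1
      have h2 := (hy m).1
      simp only [Finsupp.add_apply, Finsupp.smul_apply]
      calc _ ≤ ‖a • x m‖ + ‖b • y m‖ := norm_add_le _ _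
        _ ≤ a * 1 + b * 1 := by
          rw [norm_smul, norm_smul, Real.norm_of_nonneg ha, Real.norm_of_nonneg hb]; gcongr
        _ = 1 := by linarith
    · intro hm
      simp [(hx m).2 hm, (hy m).2 hm]
  set L : (ℕ →₀ ℂ) →ₗ[ℝ] E := (Finsupp.linearCombination ℂ u).restrictScalars ℝ with hL
  set K := L '' K0 with hK
  have hKc : Convex ℝ K := hK0c.linear_image L
  have hdense : v ∈ closure K := by
    by_contra hv
    obtain ⟨f, b, hf1, hf2⟩ := RCLike.geometric_hahn_banach_closed_point (𝕜 := ℂ) hKc.closure isClosed_closure hv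
    have hfK : ∀ x ∈ K, (f x).re < b := fun x hx => hf1 x (subset_closure hx)
    have h0 : 0 < b := by
      have := hfK 0 ⟨0, by intro m; simp, by simp⟩
      simpa using this
    have hf0 : f ≠ 0 := by
      rintro rfl
      simp at hf2; linarith
    apply hu f hf0
    rw [← summable_nat_add_iff M]
    apply summable_of_sum_range_le (c := b) (fun _ => norm_nonneg _)
    intro n
    set c : ℕ →₀ ℂ := ∑ m ∈ Finset.range n, Finsupp.single (m + M) ((starRingEnd ℂ) (f (u (m + M))) / ‖f (u (m + M))‖) with hc
    have hcv : ∀ k, c k = if M ≤ k ∧ k < n + M then (starRingEnd ℂ) (f (u k)) / ‖f (u k)‖ else 0 := by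
      intro k
      rw [hc, Finsupp.finsetSum_apply]
      simp_rw [Finsupp.single_apply]
      split_ifs with h
      · rw [Finset.sum_eq_single (k - M)]
        · rw [if_pos (by lia), show k - M + M = k by lia]
        · intro j _ hj; rw [if_neg (by lia)]
        · intro hk; exfalso; apply hk; rw [Finset.mem_range]; lia
      · apply Finset.sum_eq_zero
        intro j hj
        have := Finset.mem_range.1 hj
        rw [if_neg (by lia)]
    have hcK : c ∈ K0 := by
      intro m
      rw [hcv]
      split_ifs with h
      · refine ⟨?_, fun h' => by lia⟩
        rw [norm_div, RCLike.norm_conj]; simp; exact div_self_le_one _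
      · simp
    have := hfK (L c) ⟨c, hcK, rfl⟩
    have e : f (L c) = ((∑ m ∈ Finset.range n, ‖f (u (m + M))‖ : ℝ) : ℂ) := by
      rw [hL, LinearMap.restrictScalars_apply, hc, map_sum, map_sum, Complex.ofReal_sum]
      apply Finset.sum_congr rfl
      intro m _
      rw [Finsupp.linearCombination_single, map_smul, smul_eq_mul, div_mul_eq_mul_div, mul_comm, Complex.mul_conj, Complex.normSq_eq_norm_sq]
      by_cases h : ‖f (u (m + M))‖ = 0
      · simp [h]
      · have : (‖f (u (m + M))‖ : ℂ) ≠ 0 := by exact_mod_cast h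
        push_cast; field_simp
    rw [e, Complex.ofReal_re] at this
    exact this.le
  obtain ⟨x, ⟨c, hc, rfl⟩, hx⟩ := Metric.mem_closure_iff.1 hdense ε hε
  refine ⟨max M (c.support.sup id + 1), c, le_max_left _ _, fun m => (hc m).1, ?_⟩
  rw [dist_comm, dist_eq_norm] at hx
  have : L c = ∑ m ∈ Finset.Ico M (max M (c.support.sup id + 1)), c m • u m := by
    rw [hL, LinearMap.restrictScalars_apply, Finsupp.linearCombination_apply, Finsupp.sum]
    apply Finset.sum_subset
    · intro m hm
      have h1 : M ≤ m := by
        by_contra h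
        exact (Finsupp.mem_support_iff.1 hm) ((hc m).2 (by lia))
      have h2 : m ≤ c.support.sup id := Finset.le_sup (f := id) hm
      rw [Finset.mem_Ico]; exact ⟨h1, lt_max_of_lt_right (by lia)⟩
    · intro m _ hm
      rw [Finsupp.notMem_support_iff.1 hm, zero_smul]
  rwa [← this]

theorem vor_linear {E : Type*} [NormedAddCommGroup E] [InnerProductSpace ℂ E] (u : ℕ → E)
    (hu : ∀ f : StrongDual ℂ E, f ≠ 0 → ¬ Summable (fun m => ‖f (u m)‖)) (hs : Summable (fun m => ‖u m‖ ^ 2))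
    (ε : ℝ) (hε : 0 < ε) :
    ∃ M0 : ℕ, ∀ M ≥ M0, ∀ v : E, ∃ (N : ℕ) (ω : ℕ → ℂ), M ≤ N ∧ (∀ m, ‖ω m‖ = 1) ∧
      ‖∑ m ∈ Finset.Ico M N, ω m • u m - v‖ < ε := by
  have h1 := (summable_iff_vanishing_norm.1 hs) ((ε / 2) ^ 2) (by positivity)
  obtain ⟨s, hs'⟩ := h1
  refine ⟨s.sup id + 1, fun M hM v => ?_⟩
  obtain ⟨N, c, hMN, hc, hlt⟩ := vor_dense u hu M v (ε / 2) (by positivity)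
  obtain ⟨ω, hω, hle⟩ := vor_round u c hc (Finset.Ico M N)
  refine ⟨N, ω, hMN, hω, ?_⟩
  have hd : Disjoint (Finset.Ico M N) s := by
    rw [Finset.disjoint_left]
    intro m hm hms
    have := Finset.le_sup (f := id) hms
    have := (Finset.mem_Ico.1 hm).1
    simp only [id] at *; lia
  have h2 := hs' _ hd
  rw [Real.norm_of_nonneg (by positivity)] at h2
  have h3 : ‖∑ m ∈ Finset.Ico M N, (ω m - c m) • u m‖ < ε / 2 := lt_of_pow_lt_pow_left₀ 2 (by positivity) (hle.trans_lt h2)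
  have e : ∑ m ∈ Finset.Ico M N, ω m • u m - v = ∑ m ∈ Finset.Ico M N, (ω m - c m) • u m + (∑ m ∈ Finset.Ico M N, c m • u m - v) := by
    simp_rw [sub_smul]; rw [Finset.sum_sub_distrib]; abel
  rw [e]
  calc _ ≤ _ := norm_add_le _ _
    _ < _ := by linarith


/-- the jets of `s ↦ p ^ (-s)` at `σ`, for primes `p` -/
noncomputable def vu (n : ℕ) (σ : ℝ) (p : ℕ) : EuclideanSpace ℂ (Fin n) :=
  if p.Prime then WithLp.toLp 2 (fun k : Fin n => (-(Real.log p : ℂ)) ^ (k : ℕ) * (p : ℂ) ^ (-(σ : ℂ))) else 0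

theorem vu_coord_norm (σ : ℝ) (p : ℕ) (hp : 0 < p) (k : ℕ) :
    ‖(-(Real.log p : ℂ)) ^ k * (p : ℂ) ^ (-(σ : ℂ))‖ = Real.log p ^ k * (p:ℝ) ^ (-σ) := by
  rw [norm_mul, norm_pow, norm_neg, Complex.norm_real, Real.norm_of_nonneg (Real.log_natCast_nonneg p),
    Complex.norm_natCast_cpow_of_pos hp]
  simp

open Filter Asymptotics in
theorem vu_summable (n : ℕ) (σ : ℝ) (hσ : 1 / 2 < σ) : Summable (fun p => ‖vu n σ p‖ ^ 2) := by
  have hk : ∀ k : Fin n, Summable (fun p : ℕ => (Real.log p ^ (k:ℕ) * (p:ℝ) ^ (-σ)) ^ 2) := by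
    intro k
    have h1 : Summable (fun p : ℕ => (p:ℝ) ^ (-(σ + 1/2))) := by
      rw [Real.summable_nat_rpow]; linarith
    apply summable_of_isBigO_nat h1
    have h2 := (isLittleO_log_rpow_rpow_atTop (s := σ - 1/2) (2 * (k:ℕ) : ℝ) (by linarith)).isBigO
    have h3 := (h2.comp_tendsto tendsto_natCast_atTop_atTop).mul
      (isBigO_refl (fun p : ℕ => (p:ℝ) ^ (-(2*σ))) atTop)
    refine (h3.congr' ?_ ?_)
    · filter_upwards [eventually_gt_atTop 0] with p hp
      have hp' : (0:ℝ) < p := by exact_mod_cast hp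
      simp only [Function.comp]
      rw [mul_pow, ← pow_mul, show (2 * (k:ℕ) : ℝ) = ((k * 2 : ℕ) : ℝ) by push_cast; ring, Real.rpow_natCast,
        show -(2*σ) = (-σ) * (2:ℕ) by push_cast; ring, Real.rpow_mul_natCast hp'.le]
    · filter_upwards [eventually_gt_atTop 0] with p hp
      have hp' : (0:ℝ) < p := by exact_mod_cast hp
      simp only [Function.comp]
      rw [← Real.rpow_add hp']; congr 1; ring
  have h := summable_sum (s := Finset.univ) (fun k _ => hk k)
  refine Summable.of_nonneg_of_le (fun _ => by positivity) (fun p => ?_) h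
  by_cases hp : p.Prime
  · rw [EuclideanSpace.norm_sq_eq, vu, if_pos hp]
    apply Finset.sum_le_sum
    intro k _
    simp only
    rw [vu_coord_norm σ p hp.pos]
  · rw [vu, if_neg hp]; simp only [norm_zero]
    rw [zero_pow two_ne_zero]
    positivity

open Filter in
theorem vu_not_summable (n : ℕ) (σ : ℝ) (hσ : σ ≤ 1) (f : StrongDual ℂ (EuclideanSpace ℂ (Fin n))) (hf : f ≠ 0) :
    ¬ Summable (fun p => ‖f (vu n σ p)‖) := by
  set a : Fin n → ℂ := fun k => f (EuclideanSpace.single k 1) with ha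
  set q : Polynomial ℂ := ∑ k : Fin n, Polynomial.monomial (k:ℕ) (a k) with hq
  have hfa : ∀ x : EuclideanSpace ℂ (Fin n), f x = ∑ k, x k * a k := by
    intro x
    have := (EuclideanSpace.basisFun (Fin n) ℂ).sum_repr x
    conv_lhs => rw [← this]
    rw [map_sum]
    simp [ha]
  have hq0 : q ≠ 0 := by
    intro h0
    apply hf
    have hak : ∀ k, a k = 0 := by
      intro k
      have : q.coeff k = a k := by
        rw [hq, Polynomial.finsetSum_coeff]
        simp only [Polynomial.coeff_monomial]
        rw [Finset.sum_eq_single k]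
        · simp
        · intro j _ hj
          rw [if_neg]; exact fun h => hj (Fin.ext h)
        · simp
      rw [← this, h0]; simp
    ext x
    rw [hfa]; simp [hak]
  have hval : ∀ p : ℕ, p.Prime → f (vu n σ p) = q.eval (-(Real.log p : ℂ)) * (p:ℂ) ^ (-(σ:ℂ)) := by
    intro p hp
    rw [hfa, vu, if_pos hp, hq, Polynomial.eval_finsetSum, Finset.sum_mul]
    apply Finset.sum_congr rfl
    intro k _
    rw [Polynomial.eval_monomial]; ring
  have hlow : ∃ c > 0, ∀ᶠ p : ℕ in atTop, c ≤ ‖q.eval (-(Real.log p : ℂ))‖ := by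
    rcases lt_or_ge 0 q.degree with h | h
    · refine ⟨1, one_pos, ?_⟩
      have ht := q.tendsto_norm_atTop h (l := atTop) (z := fun p : ℕ => (-(Real.log p : ℂ))) (by
        simp only [norm_neg, Complex.norm_real]
        exact tendsto_norm_atTop_atTop.comp (Real.tendsto_log_atTop.comp tendsto_natCast_atTop_atTop))
      exact ht.eventually_ge_atTop 1
    · rw [Polynomial.eq_C_of_degree_le_zero h] at hq0 ⊢
      refine ⟨‖q.coeff 0‖, ?_, ?_⟩
      · simpa using hq0
      · simp
  obtain ⟨c, hc, hev⟩ := hlow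
  intro hsum
  apply not_summable_one_div_on_primes
  have hsum2 := hsum.mul_left c⁻¹
  apply summable_of_isBigO_nat hsum2
  apply Asymptotics.IsBigO.of_bound 1
  filter_upwards [hev, eventually_gt_atTop 0] with p hp hp0
  have hp0' : (1:ℝ) ≤ p := by exact_mod_cast hp0
  rw [one_mul]
  by_cases hpp : p.Prime
  · rw [Set.indicator_of_mem (by exact hpp), hval p hpp, norm_mul (Polynomial.eval _ _), Complex.norm_natCast_cpow_of_pos hp0]
    rw [Real.norm_of_nonneg (by positivity), Real.norm_of_nonneg (by positivity)]
    have h1 : (1:ℝ) / p ≤ (p:ℝ) ^ (-σ) := by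
      rw [one_div, ← Real.rpow_neg_one]
      exact Real.rpow_le_rpow_of_exponent_le hp0' (by linarith)
    have h2 : (1:ℝ) ≤ c⁻¹ * ‖q.eval (-(Real.log p : ℂ))‖ := by
      rw [inv_mul_eq_div, one_le_div hc]; exact hp
    have h3 : (-(σ:ℂ)).re = -σ := by simp
    rw [h3, ← mul_assoc]
    calc (1:ℝ)/p ≤ 1 * (p:ℝ) ^ (-σ) := by rw [one_mul]; exact h1
      _ ≤ _ := by gcongr
  · rw [Set.indicator_of_notMem (by exact hpp)]; rw [norm_zero]; positivity


/-- logarithm of an Euler factor -/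
noncomputable def vl (p : ℕ) (w : ℂ) (s : ℂ) : ℂ := -Complex.log (1 - w * (p : ℂ) ^ (-s))

theorem vz_norm (p : ℕ) (hp : p.Prime) (w : ℂ) (hw : ‖w‖ = 1) (s : ℂ) : ‖w * (p:ℂ) ^ (-s)‖ = (p:ℝ) ^ (-s.re) := by
  rw [norm_mul, hw, one_mul, Complex.norm_natCast_cpow_of_pos hp.pos]; simp

theorem vz_le (p : ℕ) (hp : p.Prime) (x : ℝ) (hx : 1 / 2 ≤ x) : (p:ℝ) ^ (-x) ≤ 3 / 4 := by
  have h2 : (2:ℝ) ≤ p := by exact_mod_cast hp.two_le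
  calc (p:ℝ) ^ (-x) ≤ (p:ℝ) ^ (-(1/2:ℝ)) := Real.rpow_le_rpow_of_exponent_le (by linarith) (by linarith)
    _ ≤ (2:ℝ) ^ (-(1/2:ℝ)) := Real.rpow_le_rpow_of_nonpos (by norm_num) h2 (by norm_num)
    _ ≤ 3 / 4 := by
      rw [Real.rpow_neg (by norm_num), ← Real.sqrt_eq_rpow]
      have : (4/3:ℝ) ≤ Real.sqrt 2 := Real.le_sqrt_of_sq_le (by norm_num)
      calc (Real.sqrt 2)⁻¹ ≤ (4/3:ℝ)⁻¹ := by gcongr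
        _ = 3 / 4 := by norm_num

theorem vz_norm_le (p : ℕ) (hp : p.Prime) (w : ℂ) (hw : ‖w‖ = 1) (s : ℂ) (hs : 1 / 2 ≤ s.re) :
    ‖w * (p:ℂ) ^ (-s)‖ ≤ 3 / 4 := by
  rw [vz_norm p hp w hw]; exact vz_le p hp _ hs

theorem vz_slit (p : ℕ) (hp : p.Prime) (w : ℂ) (hw : ‖w‖ = 1) (s : ℂ) (hs : 1 / 2 ≤ s.re) :
    1 - w * (p:ℂ) ^ (-s) ∈ Complex.slitPlane := by
  left
  have h1 := vz_norm_le p hp w hw s hs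
  have h2 := Complex.re_le_norm (w * (p:ℂ) ^ (-s))
  simp only [Complex.sub_re, Complex.one_re]
  linarith

theorem vz_diff (p : ℕ) (hp : p.Prime) (w : ℂ) (s : ℂ) :
    DifferentiableAt ℂ (fun s => w * (p:ℂ) ^ (-s)) s := by
  have : (p:ℂ) ≠ 0 := by exact_mod_cast hp.ne_zero
  apply DifferentiableAt.const_mul
  exact (differentiable_neg.differentiableAt).const_cpow (Or.inl this)

theorem vl_diff (p : ℕ) (hp : p.Prime) (w : ℂ) (hw : ‖w‖ = 1) (s : ℂ) (hs : 1 / 2 ≤ s.re) :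
    DifferentiableAt ℂ (vl p w) s := by
  unfold vl
  exact (((differentiableAt_const 1).sub (vz_diff p hp w s)).clog (vz_slit p hp w hw s hs)).neg

theorem vor_analytic (f : ℂ → ℂ) (h : ∀ s : ℂ, 1 / 2 ≤ s.re → DifferentiableAt ℂ f s) (s : ℂ) (hs : 1 / 2 < s.re) :
    AnalyticAt ℂ f s := by
  have ho : IsOpen {s : ℂ | 1 / 2 < s.re} := isOpen_lt continuous_const Complex.continuous_re
  have : DifferentiableOn ℂ f {s : ℂ | 1 / 2 < s.re} :=
    fun z hz => (h z (le_of_lt hz)).differentiableWithinAt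
  exact this.analyticAt (ho.mem_nhds hs)

theorem vl_sub_le (p : ℕ) (hp : p.Prime) (w : ℂ) (hw : ‖w‖ = 1) (s : ℂ) (hs : 1 / 2 ≤ s.re) :
    ‖vl p w s - w * (p:ℂ) ^ (-s)‖ ≤ 2 * (p:ℝ) ^ (-(2 * s.re)) := by
  have h1 := vz_norm_le p hp w hw s hs
  have h2 := Complex.norm_log_one_add_sub_self_le (z := -(w * (p:ℂ) ^ (-s))) (by rw [norm_neg]; linarith)
  have h3 : vl p w s - w * (p:ℂ) ^ (-s) = -(Complex.log (1 + -(w * (p:ℂ) ^ (-s))) - -(w * (p:ℂ) ^ (-s))) := by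
    unfold vl; rw [← sub_eq_add_neg]; ring
  rw [h3, norm_neg]
  refine h2.trans ?_
  rw [norm_neg]
  have h4 : (1 - ‖w * (p:ℂ) ^ (-s)‖)⁻¹ ≤ 4 := by
    rw [inv_le_comm₀ (by linarith) (by norm_num)]; linarith
  have h5 : ‖w * (p:ℂ) ^ (-s)‖ ^ 2 = (p:ℝ) ^ (-(2 * s.re)) := by
    rw [vz_norm p hp w hw, show -(2 * s.re) = (-s.re) * (2:ℕ) by push_cast; ring, Real.rpow_mul_natCast (by positivity)]
  rw [h5]
  have h6 : 0 ≤ (p:ℝ) ^ (-(2 * s.re)) := by positivity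
  nlinarith [mul_le_mul_of_nonneg_left h4 h6]

theorem vz_iter (p : ℕ) (hp : p.Prime) (w : ℂ) (k : ℕ) :
    iteratedDeriv k (fun s : ℂ => w * (p:ℂ) ^ (-s)) = fun s : ℂ => w * ((-(Real.log p : ℂ)) ^ k * (p:ℂ) ^ (-s)) := by
  have hp0 : (p:ℂ) ≠ 0 := by exact_mod_cast hp.ne_zero
  induction k with
  | zero => simp
  | succ k ih =>
    rw [iteratedDeriv_succ, ih]
    funext s
    have h : HasDerivAt (fun s : ℂ => (p:ℂ) ^ (-s)) ((p:ℂ) ^ (-s) * Complex.log p * (-1)) s :=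
      (hasDerivAt_neg s).const_cpow (Or.inl hp0)
    have h2 := ((h.const_mul ((-(Real.log p : ℂ)) ^ k)).const_mul w).deriv
    rw [h2, ← Complex.natCast_log]; ring

theorem vl_jet (p : ℕ) (hp : p.Prime) (w : ℂ) (hw : ‖w‖ = 1) (σ r : ℝ) (hr : 0 < r) (h1 : 1 / 2 ≤ σ - r) (k : ℕ) :
    ‖iteratedDeriv k (vl p w) σ - w * ((-(Real.log p : ℂ)) ^ k * (p:ℂ) ^ (-(σ:ℂ)))‖ ≤
      (k.factorial * 2 / r ^ k) * (p:ℝ) ^ (-(2 * (σ - r))) := by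
  have hs : ∀ s ∈ Metric.closedBall (σ:ℂ) r, σ - r ≤ s.re := by
    intro s hs
    rw [mem_closedBall_iff_norm] at hs
    have := (Complex.abs_re_le_norm (s - σ)).trans hs
    simp at this
    have := (abs_le.1 this).1
    linarith
  have hσ : 1 / 2 < (σ:ℂ).re := by simp; linarith
  have ha1 := vor_analytic (vl p w) (vl_diff p hp w hw) σ hσ
  have ha2 := vor_analytic _ (fun s _ => vz_diff p hp w s) σ hσ
  have key := Complex.norm_iteratedDeriv_le_of_forall_mem_sphere_norm_le (c := (σ:ℂ)) (R := r)
    (C := 2 * (p:ℝ) ^ (-(2 * (σ - r)))) (f := fun s => vl p w s - w * (p:ℂ) ^ (-s)) k hr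
    (by
      apply DifferentiableOn.diffContOnCl
      intro s h
      have h' := hs s (Metric.closure_ball_subset_closedBall h)
      exact ((vl_diff p hp w hw s (by linarith)).sub (vz_diff p hp w s)).differentiableWithinAt)
    (by
      intro s h
      have h' := hs s (Metric.sphere_subset_closedBall h)
      refine (vl_sub_le p hp w hw s (by linarith)).trans ?_
      have : (1:ℝ) ≤ p := by exact_mod_cast hp.one_le
      gcongr)
  rw [iteratedDeriv_fun_sub ha1.contDiffAt ha2.contDiffAt, vz_iter p hp] at key
  refine key.trans (le_of_eq ?_)
  ring

theorem vor_step1 (σ : ℝ) (hσ : 1 / 2 < σ) (hσ' : σ ≤ 1) (n : ℕ) (b : Fin n → ℂ) (ε : ℝ) (hε : 0 < ε) (M1 : ℕ) :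
    ∃ (N : ℕ) (ω : ℕ → ℂ), M1 ≤ N ∧ (∀ p, ‖ω p‖ = 1) ∧ ∀ k : Fin n,
      ‖iteratedDeriv k (fun s => ∑ p ∈ (Finset.range N).filter Nat.Prime, vl p (ω p) s) σ - b k‖ < ε := by
  classical
  set r : ℝ := (σ - 1 / 2) / 2 with hr
  have hr0 : 0 < r := by rw [hr]; linarith
  have hr1 : 1 / 2 < σ - r := by rw [hr]; linarith
  have hσc : 1 / 2 < (σ:ℂ).re := by simpa using hσ
  set K : ℝ := ∑ k : Fin n, ((k:ℕ).factorial * 2 / r ^ (k:ℕ)) with hK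
  have hK0 : 0 ≤ K := by rw [hK]; positivity
  have hKk : ∀ k : Fin n, ((k:ℕ).factorial * 2 / r ^ (k:ℕ)) ≤ K := by
    intro k
    exact Finset.single_le_sum (f := fun k : Fin n => ((k:ℕ).factorial * 2 / r ^ (k:ℕ) : ℝ))
      (fun i _ => by positivity) (Finset.mem_univ k)
  set J : ℕ → ℕ → ℂ → ℂ := fun k p w => if p.Prime then iteratedDeriv k (vl p w) σ else 0 with hJ
  have hiter : ∀ (N : ℕ) (ω : ℕ → ℂ), (∀ p, ‖ω p‖ = 1) → ∀ k,
      iteratedDeriv k (fun s => ∑ p ∈ (Finset.range N).filter Nat.Prime, vl p (ω p) s) σ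
        = ∑ p ∈ Finset.range N, J k p (ω p) := by
    intro N ω hω k
    rw [iteratedDeriv_fun_sum, Finset.sum_filter]
    intro p hp
    have hp' := (Finset.mem_filter.1 hp).2
    exact (vor_analytic _ (vl_diff p hp' _ (hω p)) σ hσc).contDiffAt
  have hJle : ∀ (k : Fin n) (p : ℕ) (w : ℂ), ‖w‖ = 1 →
      ‖J k p w - w * (vu n σ p) k‖ ≤ K * (p:ℝ) ^ (-(2 * (σ - r))) := by
    intro k p w hw
    by_cases hp : p.Prime
    · simp only [hJ, vu, if_pos hp]
      refine (vl_jet p hp w hw σ r hr0 hr1.le k).trans ?_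
      gcongr
      exact hKk k
    · simp only [hJ, vu, if_neg hp]
      simp only [PiLp.zero_apply, mul_zero, sub_zero, norm_zero]
      positivity
  have hsum : Summable (fun p : ℕ => K * (p:ℝ) ^ (-(2 * (σ - r)))) := by
    apply Summable.mul_left
    rw [Real.summable_nat_rpow]; linarith
  obtain ⟨s, hs⟩ := summable_iff_vanishing_norm.1 hsum (ε / 2) (by positivity)
  obtain ⟨M0, hM0⟩ := vor_linear (vu n σ) (vu_not_summable n σ hσ') (vu_summable n σ hσ) (ε / 2) (by positivity)
  obtain ⟨B, hB⟩ := s.exists_nat_subset_range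
  set M := max M0 (max M1 B) with hM
  obtain ⟨N, ω', hMN, hω', hlt⟩ := hM0 M (le_max_left _ _)
    (WithLp.toLp 2 (fun k : Fin n => b k - ∑ p ∈ Finset.range M, J k p 1))
  refine ⟨N, fun p => if p < M then 1 else ω' p, ?_, ?_, ?_⟩
  · exact le_trans (le_trans (le_max_left M1 B) (le_max_right _ _)) hMN
  · intro p; by_cases h : p < M <;> simp [h, hω']
  · intro k
    rw [hiter _ _ (by intro p; by_cases h : p < M <;> simp [h, hω'])]
    rw [← Finset.sum_range_add_sum_Ico _ hMN]
    have e1 : ∑ p ∈ Finset.range M, J k p (if p < M then 1 else ω' p) = ∑ p ∈ Finset.range M, J k p 1 := by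
      apply Finset.sum_congr rfl
      intro p hp; rw [if_pos (Finset.mem_range.1 hp)]
    have e2 : ∑ p ∈ Finset.Ico M N, J k p (if p < M then 1 else ω' p) = ∑ p ∈ Finset.Ico M N, J k p (ω' p) := by
      apply Finset.sum_congr rfl
      intro p hp; rw [if_neg (not_lt.2 (Finset.mem_Ico.1 hp).1)]
    rw [e1, e2]
    have hk := (PiLp.norm_apply_le (∑ m ∈ Finset.Ico M N, ω' m • vu n σ m -
      WithLp.toLp 2 (fun k : Fin n => b k - ∑ p ∈ Finset.range M, J k p 1)) k).trans_lt hlt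
    have e3 : (∑ m ∈ Finset.Ico M N, ω' m • vu n σ m -
      WithLp.toLp 2 (fun k : Fin n => b k - ∑ p ∈ Finset.range M, J k p 1)) k =
        ∑ m ∈ Finset.Ico M N, ω' m * vu n σ m k - (b k - ∑ p ∈ Finset.range M, J k p 1) := by
      simp
    rw [e3] at hk
    have htail : ‖∑ p ∈ Finset.Ico M N, (J k p (ω' p) - ω' p * vu n σ p k)‖ < ε / 2 := by
      refine lt_of_le_of_lt (norm_sum_le_of_le _ (fun p _ => hJle k p (ω' p) (hω' p))) ?_
      refine lt_of_le_of_lt (le_abs_self _) (hs _ ?_)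
      rw [Finset.disjoint_left]
      intro p hp hp'
      have h1 := Finset.mem_range.1 (hB hp')
      have h2 := (Finset.mem_Ico.1 hp).1
      have h3 : B ≤ M := le_trans (le_max_right M1 B) (le_max_right _ _)
      omega
    rw [Finset.sum_sub_distrib] at htail
    have := (norm_add_le _ _).trans_lt (add_lt_add htail hk)
    rw [add_halves] at this
    refine lt_of_eq_of_lt ?_ this
    congr 1
    abel


/-- Euler factor -/
noncomputable def vE (p : ℕ) (w : ℂ) (s : ℂ) : ℂ := (1 - w * (p : ℂ) ^ (-s))⁻¹

theorem vz_ne (p : ℕ) (hp : p.Prime) (w : ℂ) (hw : ‖w‖ = 1) (s : ℂ) (hs : 1 / 2 ≤ s.re) :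
    1 - w * (p:ℂ) ^ (-s) ≠ 0 := Complex.slitPlane_ne_zero (vz_slit p hp w hw s hs)

theorem vl_exp (p : ℕ) (hp : p.Prime) (w : ℂ) (hw : ‖w‖ = 1) (s : ℂ) (hs : 1 / 2 ≤ s.re) :
    Complex.exp (vl p w s) = vE p w s := by
  rw [vl, Complex.exp_neg, Complex.exp_log (vz_ne p hp w hw s hs), vE]

theorem vE_diff (p : ℕ) (hp : p.Prime) (w : ℂ) (hw : ‖w‖ = 1) (s : ℂ) (hs : 1 / 2 ≤ s.re) :
    DifferentiableAt ℂ (vE p w) s := by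
  unfold vE
  exact ((differentiableAt_const 1).sub (vz_diff p hp w s)).inv (vz_ne p hp w hw s hs)

theorem vor_iter_pow (c σ : ℂ) (j k : ℕ) :
    iteratedDeriv k (fun z : ℂ => c * (z - σ) ^ j) σ = if j = k then c * k.factorial else 0 := by
  have h := iteratedDeriv_comp_sub_const k (fun z : ℂ => c * z ^ j) σ
  rw [congrFun h σ]
  simp only [sub_self]
  rw [iteratedDeriv_const_mul_field, iteratedDeriv_fun_pow_zero]
  split_ifs with h1 h2 h2
  · rw [h1]
  · exact absurd h1.symm h2
  · exact absurd h2.symm h1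
  · simp

open Filter Topology in
theorem vor_step2 (σ : ℂ) (n : ℕ) (a : ℕ → ℂ) (ha : a 0 ≠ 0) (hn : 0 < n) :
    ∃ g : ℂ → ℂ, AnalyticAt ℂ g σ ∧ ∀ k < n, iteratedDeriv k (fun z => Complex.exp (g z)) σ = a k := by
  set A : ℂ → ℂ := fun z => ∑ j ∈ Finset.range n, (a j / j.factorial) * (z - σ) ^ j with hA
  have hAan : AnalyticAt ℂ A σ := by
    have : Differentiable ℂ A := by
      rw [hA]; fun_prop
    exact this.analyticAt σ
  have hAσ : A σ = a 0 := by
    simp only [hA, sub_self]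
    rw [Finset.sum_eq_single 0]
    · simp
    · intro j _ hj; simp [hj]
    · intro h; exact absurd (Finset.mem_range.2 hn) h
  refine ⟨fun z => Complex.log (a 0) + Complex.log (A z / a 0), ?_, ?_⟩
  · apply analyticAt_const.add
    apply AnalyticAt.clog
    · exact hAan.div analyticAt_const ha
    · rw [hAσ, div_self ha]; exact Complex.one_mem_slitPlane
  · intro k hk
    have hev : (fun z => Complex.exp (Complex.log (a 0) + Complex.log (A z / a 0))) =ᶠ[𝓝 σ] A := by
      have : ∀ᶠ z in 𝓝 σ, A z ≠ 0 := hAan.continuousAt.eventually_ne (by rw [hAσ]; exact ha)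
      filter_upwards [this] with z hz
      rw [Complex.exp_add, Complex.exp_log ha, Complex.exp_log (div_ne_zero hz ha)]
      field_simp
    rw [hev.iteratedDeriv_eq k, hA, iteratedDeriv_fun_sum]
    · simp only [vor_iter_pow]
      rw [Finset.sum_ite_eq']
      rw [if_pos (Finset.mem_range.2 hk)]
      have : (k.factorial : ℂ) ≠ 0 := by exact_mod_cast k.factorial_ne_zero
      field_simp
    · intro j _
      exact ContDiff.contDiffAt (by fun_prop)

open Filter Topology in
theorem vor_step3 (σ : ℝ) (hσ : 1 / 2 < σ) (hσ' : σ ≤ 1) (n : ℕ) (hn : 0 < n) (a : ℕ → ℂ) (ha : a 0 ≠ 0) :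
    ∃ (N : ℕ → ℕ) (ω : ℕ → ℕ → ℂ), (∀ ν, ν ≤ N ν) ∧ (∀ ν p, ‖ω ν p‖ = 1) ∧ ∀ k < n,
      Tendsto (fun ν => iteratedDeriv k (fun s => ∏ p ∈ (Finset.range (N ν)).filter Nat.Prime, vE p (ω ν p) s) σ)
        atTop (𝓝 (a k)) := by
  obtain ⟨g, hg, hgk⟩ := vor_step2 (σ:ℂ) n a ha hn
  have hσc : 1 / 2 < (σ:ℂ).re := by simpa using hσ
  have h := fun ν : ℕ => vor_step1 σ hσ hσ' n (fun k => iteratedDeriv k g σ) (1 / ((ν:ℝ) + 1)) (by positivity) ν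
  choose N ω hN hω hlt using h
  refine ⟨N, ω, hN, hω, ?_⟩
  intro k hk
  have hj := jc_exp (l := atTop) (c := (σ:ℂ)) (n := n) (f := g)
    (F := fun ν s => ∑ p ∈ (Finset.range (N ν)).filter Nat.Prime, vl p (ω ν p) s) (by
      intro ν
      apply vor_analytic _ _ _ hσc
      intro s hs
      apply DifferentiableAt.fun_sum
      intro p hp
      exact vl_diff p (Finset.mem_filter.1 hp).2 _ (hω ν p) s hs) hg (by
      intro k hk
      rw [tendsto_iff_norm_sub_tendsto_zero]
      exact squeeze_zero (fun _ => norm_nonneg _) (fun ν => (hlt ν ⟨k, hk⟩).le) tendsto_one_div_add_atTop_nhds_zero_nat)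
    k hk
  rw [hgk k hk] at hj
  refine hj.congr (fun ν => ?_)
  apply Filter.EventuallyEq.iteratedDeriv_eq
  have ho : IsOpen {s : ℂ | 1 / 2 < s.re} := isOpen_lt continuous_const Complex.continuous_re
  filter_upwards [ho.mem_nhds hσc] with s hs
  rw [Complex.exp_sum]
  apply Finset.prod_congr rfl
  intro p hp
  exact vl_exp p (Finset.mem_filter.1 hp).2 _ (hω ν p) s (le_of_lt hs)

open Filter Topology in
theorem vE_jet (p : ℕ) (hp : p.Prime) (w w' : ℂ) (hw : ‖w‖ = 1) (hw' : ‖w'‖ = 1) (σ r : ℝ) (hr : 0 < r)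
    (h1 : 1 / 2 ≤ σ - r) (k : ℕ) :
    ‖iteratedDeriv k (vE p w) σ - iteratedDeriv k (vE p w') σ‖ ≤ k.factorial * (16 * ‖w - w'‖) / r ^ k := by
  have hs : ∀ s ∈ Metric.closedBall (σ:ℂ) r, 1 / 2 ≤ s.re := by
    intro s hs
    rw [mem_closedBall_iff_norm] at hs
    have := (Complex.abs_re_le_norm (s - σ)).trans hs
    simp at this
    have := (abs_le.1 this).1
    linarith
  have hσ : 1 / 2 < (σ:ℂ).re := by simp; linarith
  have ha1 := vor_analytic _ (vE_diff p hp w hw) σ hσ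
  have ha2 := vor_analytic _ (vE_diff p hp w' hw') σ hσ
  rw [← iteratedDeriv_fun_sub ha1.contDiffAt ha2.contDiffAt]
  apply Complex.norm_iteratedDeriv_le_of_forall_mem_sphere_norm_le k hr
  · apply DifferentiableOn.diffContOnCl
    intro s h
    have h' := hs s (Metric.closure_ball_subset_closedBall h)
    exact ((vE_diff p hp w hw s h').sub (vE_diff p hp w' hw' s h')).differentiableWithinAt
  · intro s h
    have h' := hs s (Metric.sphere_subset_closedBall h)
    have n1 := vz_ne p hp w hw s h'
    have n2 := vz_ne p hp w' hw' s h'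
    have e : vE p w s - vE p w' s = (w - w') * (p:ℂ) ^ (-s) * ((1 - w * (p:ℂ) ^ (-s))⁻¹ * (1 - w' * (p:ℂ) ^ (-s))⁻¹) := by
      unfold vE
      generalize (p:ℂ) ^ (-s) = x at n1 n2
      rw [inv_sub_inv n1 n2, ← mul_inv, ← div_eq_mul_inv]
      congr 1; ring
    have b : ∀ v : ℂ, ‖v‖ = 1 → ‖(1 - v * (p:ℂ) ^ (-s))⁻¹‖ ≤ 4 := by
      intro v hv
      have q1 := vz_norm_le p hp v hv s h'
      have q2 := norm_sub_norm_le (1:ℂ) (v * (p:ℂ) ^ (-s))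
      rw [norm_one] at q2
      rw [norm_inv, inv_le_comm₀ (by linarith) (by norm_num)]
      linarith
    have b3 : ‖(p:ℂ) ^ (-s)‖ ≤ 1 := by
      have := vz_norm_le p hp 1 (by simp) s h'
      rw [one_mul] at this; linarith
    rw [e, norm_mul, norm_mul, norm_mul]
    calc ‖w - w'‖ * ‖(p:ℂ) ^ (-s)‖ * (‖(1 - w * (p:ℂ) ^ (-s))⁻¹‖ * ‖(1 - w' * (p:ℂ) ^ (-s))⁻¹‖)
        ≤ ‖w - w'‖ * 1 * (4 * 4) := by
          gcongr
          · exact b w hw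
          · exact b w' hw'
      _ = 16 * ‖w - w'‖ := by ring


/-- tail of the zeta series -/
noncomputable def vρ (x : ℝ) (N : ℕ) : ℝ := ∑' m : ℕ, ((m + N : ℕ) : ℝ) ^ (-(2 * x))

/-- the product of the primes below `N` -/
def vPr (N : ℕ) : ℕ := ∏ p ∈ (Finset.range N).filter Nat.Prime, p

theorem vPr_primeFactors (N : ℕ) : (vPr N).primeFactors = (Finset.range N).filter Nat.Prime := by
  unfold vPr
  exact Nat.primeFactors_prod (fun p hp => (Finset.mem_filter.1 hp).2)

theorem vPr_ne (N : ℕ) : vPr N ≠ 0 := by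
  unfold vPr
  exact Finset.prod_ne_zero_iff.2 (fun p hp => (Finset.mem_filter.1 hp).2.ne_zero)

theorem vρ_bound (x : ℝ) (hx : 1 / 2 < x) (N M : ℕ) :
    ∑ n ∈ (Finset.Icc 2 M).filter (Nat.Coprime (vPr N)), (n:ℝ) ^ (-(2 * x)) ≤ vρ x N := by
  have hs : Summable (fun n : ℕ => (n:ℝ) ^ (-(2 * x))) := by
    rw [Real.summable_nat_rpow]; linarith
  have h1 := hs.sum_add_tsum_nat_add N
  have hd : Disjoint (Finset.range N) ((Finset.Icc 2 M).filter (Nat.Coprime (vPr N))) := by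
    rw [Finset.disjoint_left]
    intro n hn hn'
    rw [Finset.mem_filter, Finset.mem_Icc] at hn'
    rw [Finset.mem_range] at hn
    have hp : n.minFac.Prime := Nat.minFac_prime (by omega)
    have hle : n.minFac ≤ n := Nat.minFac_le (by omega)
    have hdvd : n.minFac ∣ vPr N := by
      unfold vPr
      exact Finset.dvd_prod_of_mem (fun p => p) (Finset.mem_filter.2 ⟨Finset.mem_range.2 (by omega), hp⟩)
    have := Nat.dvd_gcd hdvd n.minFac_dvd
    rw [hn'.2] at this
    exact hp.one_lt.ne' (Nat.dvd_one.1 this)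
  have h2 := hs.sum_le_tsum (Finset.range N ∪ (Finset.Icc 2 M).filter (Nat.Coprime (vPr N)))
    (fun n _ => by positivity)
  rw [Finset.sum_union hd] at h2
  unfold vρ
  linarith

open Filter Topology in
theorem vρ_tendsto (x : ℝ) : Tendsto (vρ x) atTop (𝓝 0) :=
  tendsto_sum_nat_add (fun n : ℕ => (n:ℝ) ^ (-(2 * x)))

open Filter Topology in
theorem vor_step4 (σ r : ℝ) (hr : r = (σ - 1 / 2) / 2) (hσ : 1 / 2 < σ) (hσ' : σ ≤ 1) (n N : ℕ) (hN : 3 ≤ N)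
    (ω : ℕ → ℂ) (hω : ∀ p, ‖ω p‖ = 1) (ε : ℝ) (hε : 0 < ε) :
    ∃ t : ℝ, 8 ≤ t ∧ (∀ k < n,
      ‖iteratedDeriv k (fun s => ∏ p ∈ (Finset.range N).filter Nat.Prime, vE p ((p:ℂ) ^ (-(t * Complex.I))) s) σ -
       iteratedDeriv k (fun s => ∏ p ∈ (Finset.range N).filter Nat.Prime, vE p (ω p) s) σ‖ < ε) ∧
      ∫ φ in (0:ℝ)..(2 * Real.pi), ‖vL (vPr N) (circleMap σ r φ + t * Complex.I) - 1‖ ^ 2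
        < 8 * Real.pi * vρ (σ - r) N + ε := by
  have hr0 : 0 < r := by rw [hr]; linarith
  have hr1 : 1 / 2 < σ - r := by rw [hr]; linarith
  have hσc : 1 / 2 < (σ:ℂ).re := by simpa using hσ
  have hρ0 : 0 ≤ vρ (σ - r) N := tsum_nonneg (fun _ => by positivity)
  have h := fun j : ℕ => vor_choose ((Finset.range N).filter Nat.Prime)
    ⟨2, Finset.mem_filter.2 ⟨Finset.mem_range.2 (by omega), Nat.prime_two⟩⟩
    (fun p hp => (Finset.mem_filter.1 hp).2) (vPr N) (vPr_primeFactors N) (vPr_ne N) ω hω (σ - r) (vρ (σ - r) N) hr1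
    (fun M => vρ_bound _ hr1 N M) σ r hr0 (by rw [hr]; linarith) le_rfl (by rw [hr]; linarith)
    (8 * Real.pi * vρ (σ - r) N + ε) (by positivity) (by linarith) (1 / ((j:ℝ) + 1)) (by positivity)
  choose t ht hclose hintg using h
  have hw : ∀ j p, p ∈ (Finset.range N).filter Nat.Prime → ‖(p:ℂ) ^ (-(t j * Complex.I))‖ = 1 :=
    fun j p hp => vor_cpow_norm p (Finset.mem_filter.1 hp).2.ne_zero (t j)
  have hj := jc_prod (l := atTop) (c := (σ:ℂ)) (n := n) ((Finset.range N).filter Nat.Prime)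
    (fun p (j : ℕ) s => vE p ((p:ℂ) ^ (-(t j * Complex.I))) s) (fun p s => vE p (ω p) s)
    (fun p hp j => vor_analytic _ (vE_diff p (Finset.mem_filter.1 hp).2 _ (hw j p hp)) σ hσc)
    (fun p hp => vor_analytic _ (vE_diff p (Finset.mem_filter.1 hp).2 _ (hω p)) σ hσc)
    (by
      intro p hp k hk
      rw [tendsto_iff_norm_sub_tendsto_zero]
      have hlim : Tendsto (fun j : ℕ => (k.factorial * 16 / r ^ k) * (1 / ((j:ℝ) + 1))) atTop (𝓝 0) := by
        have := (tendsto_one_div_add_atTop_nhds_zero_nat (𝕜 := ℝ)).const_mul (k.factorial * 16 / r ^ k)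
        rwa [mul_zero] at this
      refine squeeze_zero (fun _ => norm_nonneg _) (fun j => ?_) hlim
      refine (vE_jet p (Finset.mem_filter.1 hp).2 _ _ (hw j p hp) (hω p) σ r hr0 hr1.le k).trans ?_
      have := (hclose j p hp).le
      calc (k.factorial:ℝ) * (16 * ‖(p:ℂ) ^ (-(t j * Complex.I)) - ω p‖) / r ^ k
          = (k.factorial * 16 / r ^ k) * ‖(p:ℂ) ^ (-(t j * Complex.I)) - ω p‖ := by ring
        _ ≤ _ := by gcongr)
  have hev : ∀ᶠ j in atTop, ∀ k ∈ Finset.range n,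
      ‖iteratedDeriv k (fun s => ∏ p ∈ (Finset.range N).filter Nat.Prime, vE p ((p:ℂ) ^ (-(t j * Complex.I))) s) σ -
       iteratedDeriv k (fun s => ∏ p ∈ (Finset.range N).filter Nat.Prime, vE p (ω p) s) σ‖ < ε := by
    rw [Filter.eventually_all_finset]
    intro k hk
    have := tendsto_iff_norm_sub_tendsto_zero.1 (hj k (Finset.mem_range.1 hk))
    exact this.eventually_lt_const hε
  obtain ⟨j, hj'⟩ := hev.exists
  exact ⟨t j, ht j, fun k hk => hj' k (Finset.mem_range.2 hk), hintg j⟩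

open Filter Topology in
theorem vor_main (σ : ℝ) (hσ : 1 / 2 < σ) (hσ' : σ ≤ 1) (n : ℕ) (hn : 0 < n) (a : ℕ → ℂ) (ha : a 0 ≠ 0) :
    ∃ t : ℕ → ℝ, ∀ k < n, Tendsto (fun ν => iteratedDeriv k riemannZeta (σ + t ν * Complex.I)) atTop (𝓝 (a k)) := by
  obtain ⟨N, ω, hN, hω, hlim⟩ := vor_step3 σ hσ hσ' n hn a ha
  obtain ⟨g, hg, hgk⟩ := vor_step2 (σ:ℂ) n a ha hn
  have hσc : 1 / 2 < (σ:ℂ).re := by simpa using hσ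
  obtain ⟨r, hr⟩ : ∃ r : ℝ, r = (σ - 1 / 2) / 2 := ⟨_, rfl⟩
  have hr0 : 0 < r := by rw [hr]; linarith
  have hr1 : 1 / 2 < σ - r := by rw [hr]; linarith
  have h4 := fun ν : ℕ => vor_step4 σ r hr hσ hσ' n (N (ν + 3)) (by have := hN (ν + 3); omega)
    (ω (ν + 3)) (hω (ν + 3)) (1 / ((ν:ℝ) + 1)) (by positivity)
  choose t ht hclose hintg using h4
  refine ⟨t, ?_⟩
  set η : ℕ → ℝ := fun ν => 8 * Real.pi * vρ (σ - r) (N (ν + 3)) + 1 / ((ν:ℝ) + 1) with hη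
  have hρ0 : ∀ M, 0 ≤ vρ (σ - r) M := fun M => tsum_nonneg (fun _ => by positivity)
  have hη0 : ∀ ν, 0 < η ν := by
    intro ν
    have := hρ0 (N (ν + 3))
    simp only [hη]; positivity
  have hNt : Tendsto (fun ν => N (ν + 3)) atTop atTop :=
    tendsto_atTop_mono (fun ν => by have := hN (ν + 3); simp only [id]; omega) tendsto_id
  have hηt : Tendsto η atTop (𝓝 0) := by
    have h1 := ((vρ_tendsto (σ - r)).comp hNt).const_mul (8 * Real.pi)
    have h2 := h1.add (tendsto_one_div_add_atTop_nhds_zero_nat (𝕜 := ℝ))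
    rw [mul_zero, add_zero] at h2
    exact h2
  have hsq : Tendsto (fun ν => Real.sqrt (η ν)) atTop (𝓝 0) := by
    have := (Real.continuous_sqrt.tendsto 0).comp hηt
    rwa [Real.sqrt_zero] at this
  have hball : ∀ s ∈ Metric.closedBall (σ:ℂ) r, |s.im| < 2 := by
    intro s hs
    rw [mem_closedBall_iff_norm] at hs
    have := (Complex.abs_im_le_norm (s - σ)).trans hs
    simp at this
    linarith
  have hd : ∀ ν (s : ℂ), |s.im| < 2 → DifferentiableAt ℂ (fun s => vL (vPr (N (ν + 3))) (s + t ν * Complex.I)) s := by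
    intro ν s hs
    have hne : s + t ν * Complex.I ≠ 1 := by
      intro h
      have := congrArg Complex.im h
      simp at this
      have h8 := ht ν
      have := (abs_lt.1 hs).1
      linarith
    exact (vL_differentiableAt _ _ hne).comp s (f := fun s => s + t ν * Complex.I) (by fun_prop)
  have hoim : IsOpen {s : ℂ | |s.im| < 2} := isOpen_lt (by fun_prop) continuous_const
  have hσim : |(σ:ℂ).im| < 2 := by simp
  have han : ∀ ν, AnalyticAt ℂ (fun s => vL (vPr (N (ν + 3))) (s + t ν * Complex.I)) σ := by
    intro ν
    have : DifferentiableOn ℂ (fun s => vL (vPr (N (ν + 3))) (s + t ν * Complex.I)) {s : ℂ | |s.im| < 2} :=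
      fun s hs => (hd ν s hs).differentiableWithinAt
    exact this.analyticAt (hoim.mem_nhds hσim)
  have hw : ∀ ν p, p ∈ (Finset.range (N (ν + 3))).filter Nat.Prime → ‖(p:ℂ) ^ (-(t ν * Complex.I))‖ = 1 :=
    fun ν p hp => vor_cpow_norm p (Finset.mem_filter.1 hp).2.ne_zero (t ν)
  have hm := jc_mul (l := atTop) (c := (σ:ℂ)) (n := n)
    (F := fun ν s => vL (vPr (N (ν + 3))) (s + t ν * Complex.I))
    (G := fun ν s => ∏ p ∈ (Finset.range (N (ν + 3))).filter Nat.Prime, vE p ((p:ℂ) ^ (-(t ν * Complex.I))) s)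
    (f := fun _ => 1) (g := fun z => Complex.exp (g z)) han
    (by
      intro ν
      apply vor_analytic _ _ _ hσc
      intro s hs
      apply DifferentiableAt.fun_finsetProd
      intro p hp
      exact vE_diff p (Finset.mem_filter.1 hp).2 _ (hw ν p hp) s hs)
    analyticAt_const hg.cexp
    (by
      intro k hk
      rw [tendsto_iff_norm_sub_tendsto_zero]
      have hlim' : Tendsto (fun ν => k.factorial / r ^ k * Real.sqrt (η ν)) atTop (𝓝 0) := by
        have := hsq.const_mul (k.factorial / r ^ k)
        rwa [mul_zero] at this
      refine squeeze_zero (fun _ => norm_nonneg _) (fun ν => ?_) hlim'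
      rw [← iteratedDeriv_fun_sub (han ν).contDiffAt contDiffAt_const]
      apply vor_cauchy _ _ r hr0
      · apply DifferentiableOn.diffContOnCl
        intro s hs
        exact ((hd ν s (hball s (Metric.closure_ball_subset_closedBall hs))).sub
          (differentiableAt_const 1)).differentiableWithinAt
      · exact Real.sqrt_pos.2 (hη0 ν)
      · rw [Real.sq_sqrt (hη0 ν).le]
        exact (hintg ν).le)
    (by
      intro k hk
      rw [hgk k hk]
      have h1 := (hlim k hk).comp (tendsto_add_atTop_nat 3)
      have h2 : Tendsto (fun ν =>
          iteratedDeriv k (fun s => ∏ p ∈ (Finset.range (N (ν + 3))).filter Nat.Prime, vE p ((p:ℂ) ^ (-(t ν * Complex.I))) s) σ -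
          iteratedDeriv k (fun s => ∏ p ∈ (Finset.range (N (ν + 3))).filter Nat.Prime, vE p (ω (ν + 3) p) s) σ)
          atTop (𝓝 0) :=
        squeeze_zero_norm (fun ν => (hclose ν k hk).le) tendsto_one_div_add_atTop_nhds_zero_nat
      have h3 := h2.add h1
      rw [zero_add] at h3
      refine h3.congr (fun ν => ?_)
      simp only [Function.comp]
      ring)
  intro k hk
  have hm' := hm k hk
  simp only [one_mul] at hm'
  rw [hgk k hk] at hm'
  refine hm'.congr (fun ν => ?_)
  have e1 := congrFun (iteratedDeriv_comp_add_const k riemannZeta (t ν * Complex.I)) (σ:ℂ)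
  rw [← e1]
  apply Filter.EventuallyEq.iteratedDeriv_eq
  have ho : IsOpen {s : ℂ | 1 / 2 < s.re} := isOpen_lt continuous_const Complex.continuous_re
  filter_upwards [ho.mem_nhds hσc] with s hs
  rw [vL, vPr_primeFactors, mul_right_comm, ← Finset.prod_mul_distrib, Finset.prod_eq_one, one_mul]
  intro p hp
  have hpp := (Finset.mem_filter.1 hp).2
  have hp0 : (p:ℂ) ≠ 0 := by exact_mod_cast hpp.ne_zero
  rw [neg_add, Complex.cpow_add _ _ hp0, vE, mul_comm ((p:ℂ) ^ (-s))]
  exact mul_inv_cancel₀ (vz_ne p hpp _ (hw ν p hp) s (le_of_lt hs))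

open Filter Topology in
theorem voronin_density
    (σ : ℝ) (hσ : 1 / 2 < σ) (hσ' : σ ≤ 1) (n : ℕ) (hn : 0 < n) :
    Dense {v : Fin n → ℂ | ∃ t : ℝ, ∀ k : Fin n,
      v k = iteratedDeriv (k : ℕ) riemannZeta (σ + Complex.I * t)} := by
  have key : ∀ a : Fin n → ℂ, a ⟨0, hn⟩ ≠ 0 → a ∈ closure {v : Fin n → ℂ | ∃ t : ℝ, ∀ k : Fin n,
      v k = iteratedDeriv (k : ℕ) riemannZeta (σ + Complex.I * t)} := by
    intro a ha
    obtain ⟨t, ht⟩ := vor_main σ hσ hσ' n hn (fun k => if h : k < n then a ⟨k, h⟩ else 0) (by simpa [hn] using ha)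
    refine mem_closure_of_tendsto (f := fun ν (k : Fin n) => iteratedDeriv (k:ℕ) riemannZeta (σ + t ν * Complex.I))
      (b := atTop) ?_ (Eventually.of_forall fun ν => ⟨t ν, fun k => by rw [mul_comm Complex.I]⟩)
    rw [tendsto_pi_nhds]
    intro k
    have := ht k k.2
    simpa using this
  intro a
  by_cases ha : a ⟨0, hn⟩ = 0
  · rw [← closure_closure]
    refine mem_closure_of_tendsto (f := fun (ν : ℕ) => Function.update a ⟨0, hn⟩ (1 / ((ν:ℂ) + 1))) (b := atTop) ?_
      (Eventually.of_forall fun ν => key _ ?_)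
    · have h1 : Tendsto (fun ν : ℕ => Function.update a ⟨0, hn⟩ (1 / ((ν:ℂ) + 1))) atTop
          (𝓝 (Function.update a ⟨0, hn⟩ 0)) :=
        tendsto_const_nhds.update _ tendsto_one_div_add_atTop_nhds_zero_nat
      rwa [← ha, Function.update_eq_self] at h1
    · rw [Function.update_self]
      exact one_div_ne_zero (by exact_mod_cast Nat.succ_ne_zero ν)
  · exact key a ha
end

section
/- (Garunkštis–Steuding.) The set of pairs { (ζ(1/2 + it), ζ'(1/2 + it)) : t ∈ ℝ } is not dense in ℂ²; that is, there exists a nonempty open subset of ℂ² containing no point of this set. -/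
open Filter Topology in
lemma gs_deriv_aux (u : ℝ → ℝ) (u' : ℝ) (hu : HasDerivAt u u' 0)
    (h : ∀ x : ℝ, 0 < x → x < 1 / 2 → u x ≤ u (-x)) : u' ≤ 0 := by
  have h2 : HasDerivAt (fun x : ℝ => u (-x)) (-u') 0 := by
    have h3 : HasDerivAt u u' (-(0 : ℝ)) := by simpa using hu
    have h7 := h3.comp (0 : ℝ) (hasDerivAt_neg (0 : ℝ))
    rw [mul_neg_one] at h7
    exact h7
  have h4 := hu.sub h2
  have h5 := (hasDerivAt_iff_tendsto_slope.1 h4).mono_left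
    (nhdsWithin_mono (0 : ℝ) (fun x (hx : 0 < x) => ne_of_gt hx) : 𝓝[>] (0 : ℝ) ≤ _)
  have h6 : u' - -u' ≤ 0 := by
    refine le_of_tendsto h5 ?_
    have : Set.Ioo (0 : ℝ) (1 / 2) ∈ 𝓝[>] (0 : ℝ) := Ioo_mem_nhdsGT (by norm_num)
    filter_upwards [this] with x hx
    have := h x hx.1 hx.2
    rw [slope_def_field]
    simp only [Pi.sub_apply, neg_zero, sub_self, sub_zero]
    exact div_nonpos_of_nonpos_of_nonneg (by linarith) hx.1.le
  linarith

lemma gs_factor (a b y : ℝ) (ha : 0 < a) (hab : a ≤ b) :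
    ‖(b : ℂ) + Complex.I * y‖ * ‖(a : ℂ)‖ ≤ ‖(a : ℂ) + Complex.I * y‖ * ‖(b : ℂ)‖ := by
  apply le_of_sq_le_sq _ (by positivity)
  simp only [mul_pow, Complex.sq_norm, Complex.normSq_apply]
  simp
  nlinarith [mul_le_mul hab hab ha.le (ha.le.trans hab), mul_self_nonneg y,
    mul_nonneg (mul_self_nonneg y) (sub_nonneg.2 (mul_le_mul hab hab ha.le (ha.le.trans hab)))]

open Filter Topology in
lemma gs_gamma (a b y : ℝ) (ha : 0 < a) (hab : a ≤ b) :
    ‖Complex.Gamma (a + Complex.I * y)‖ * ‖Complex.Gamma b‖ ≤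
      ‖Complex.Gamma (b + Complex.I * y)‖ * ‖Complex.Gamma a‖ := by
  have T := fun s => (Complex.GammaSeq_tendsto_Gamma s).norm
  refine le_of_tendsto_of_tendsto ((T (a + Complex.I * y)).mul (T b))
    ((T (b + Complex.I * y)).mul (T a)) ?_
  filter_upwards [eventually_gt_atTop 0] with n hn
  have hb := ha.trans_le hab
  have hP : ∀ s : ℂ, ‖Complex.GammaSeq s n‖ =
      (n : ℝ) ^ s.re * (n.factorial : ℝ) / ∏ j ∈ Finset.range (n + 1), ‖s + j‖ := by
    intro s
    rw [Complex.GammaSeq, norm_div, norm_mul, norm_prod,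
      Complex.norm_natCast_cpow_of_pos hn, Complex.norm_natCast]
  have hpos : ∀ c z : ℝ, 0 < c → 0 < ∏ j ∈ Finset.range (n + 1), ‖(c : ℂ) + Complex.I * z + j‖ := by
    intro c z hc
    refine Finset.prod_pos fun j _ => norm_pos_iff.2 fun h => ?_
    have := congrArg Complex.re h
    simp at this
    have : (0 : ℝ) ≤ j := j.cast_nonneg
    linarith
  have p1 := hpos a y ha
  have p2 := hpos b y hb
  have p3 := hpos a 0 ha
  have p4 := hpos b 0 hb
  simp only [Complex.ofReal_zero, mul_zero, add_zero] at p3 p4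
  simp only [hP]
  have r : ∀ c : ℝ, ((c : ℂ) + Complex.I * y).re = c := by intro c; simp
  simp only [r, Complex.ofReal_re]
  rw [div_mul_div_comm, div_mul_div_comm]
  have key : (∏ j ∈ Finset.range (n + 1), ‖(b : ℂ) + Complex.I * y + j‖) *
      (∏ j ∈ Finset.range (n + 1), ‖(a : ℂ) + j‖) ≤
      (∏ j ∈ Finset.range (n + 1), ‖(a : ℂ) + Complex.I * y + j‖) *
      (∏ j ∈ Finset.range (n + 1), ‖(b : ℂ) + j‖) := by
    rw [← Finset.prod_mul_distrib, ← Finset.prod_mul_distrib]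
    refine Finset.prod_le_prod (fun _ _ => by positivity) fun j _ => ?_
    have := gs_factor (a + j) (b + j) y (by positivity) (by linarith)
    push_cast at this
    rw [add_right_comm _ (Complex.I * (y : ℂ)), add_right_comm _ (Complex.I * (y : ℂ))]
    exact this
  rw [mul_comm ((n : ℝ) ^ b * (n.factorial : ℝ))]
  exact div_le_div_of_nonneg_left (by positivity) (mul_pos p2 p3) key

lemma gs_gammaR (a b y : ℝ) (ha : 0 < a) (hab : a ≤ b) :
    ‖Complex.Gammaℝ (a + Complex.I * y)‖ * ‖Complex.Gammaℝ b‖ ≤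
      ‖Complex.Gammaℝ (b + Complex.I * y)‖ * ‖Complex.Gammaℝ a‖ := by
  have h := gs_gamma (a / 2) (b / 2) (y / 2) (by linarith) (by linarith)
  have e : ∀ c : ℝ, ((c / 2 : ℝ) : ℂ) + Complex.I * (y / 2 : ℝ) = (c + Complex.I * y) / 2 := by
    intro c; push_cast; ring
  have e' : ∀ c : ℝ, ((c / 2 : ℝ) : ℂ) = c / 2 := by intro c; push_cast; ring
  rw [e, e, e', e'] at h
  have hP : ∀ s : ℂ, ‖Complex.Gammaℝ s‖ = Real.pi ^ (-s.re / 2) * ‖Complex.Gamma (s / 2)‖ := by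
    intro s
    rw [Complex.Gammaℝ_def, norm_mul, Complex.norm_cpow_eq_rpow_re_of_pos Real.pi_pos]
    simp
  simp only [hP]
  have r : ∀ c : ℝ, ((c : ℂ) + Complex.I * y).re = c := by intro c; simp
  simp only [r, Complex.ofReal_re]
  have q1 : 0 < Real.pi ^ (-a / 2) := Real.rpow_pos_of_pos Real.pi_pos _
  have q2 : 0 < Real.pi ^ (-b / 2) := Real.rpow_pos_of_pos Real.pi_pos _
  have := mul_le_mul_of_nonneg_left h (mul_pos q1 q2).le
  linarith

lemma gs_gammaR_conj (s : ℂ) : ‖Complex.Gammaℝ ((starRingEnd ℂ) s)‖ = ‖Complex.Gammaℝ s‖ := by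
  have hP : ∀ s : ℂ, ‖Complex.Gammaℝ s‖ = Real.pi ^ (-s.re / 2) * ‖Complex.Gamma (s / 2)‖ := by
    intro s
    rw [Complex.Gammaℝ_def, norm_mul, Complex.norm_cpow_eq_rpow_re_of_pos Real.pi_pos]
    simp
  rw [hP, hP, Complex.conj_re]
  have : (starRingEnd ℂ) s / 2 = (starRingEnd ℂ) (s / 2) := by
    rw [map_div₀, Complex.conj_ofNat]
  rw [this, Complex.Gamma_conj, Complex.norm_conj]

lemma gs_completed (s : ℂ) (hs : 0 < s.re) :
    ‖completedRiemannZeta s‖ = ‖riemannZeta s‖ * ‖Complex.Gammaℝ s‖ := by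
  have h0 : s ≠ 0 := by rintro rfl; simp at hs
  have hG := norm_ne_zero_iff.2 (Complex.Gammaℝ_ne_zero_of_re_pos hs)
  rw [riemannZeta_def_of_ne_zero h0, norm_div, div_mul_cancel₀ _ hG]

lemma gs_main (t x : ℝ) (hx : 0 < x) (hx' : x < 1 / 2) :
    ‖riemannZeta (((1 / 2 + x : ℝ) : ℂ) + Complex.I * t) * Complex.Gammaℝ ((1 / 2 + x : ℝ) : ℂ)‖ ≤
    ‖riemannZeta (((1 / 2 - x : ℝ) : ℂ) + Complex.I * t) * Complex.Gammaℝ ((1 / 2 - x : ℝ) : ℂ)‖ := by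
  set s : ℂ := ((1 / 2 + x : ℝ) : ℂ) + Complex.I * t with hs
  set s' : ℂ := ((1 / 2 - x : ℝ) : ℂ) + Complex.I * t with hs'
  have r : s.re = 1 / 2 + x := by simp [hs]
  have r' : s'.re = 1 / 2 - x := by simp [hs']
  have e : 1 - s = (starRingEnd ℂ) s' := by
    rw [hs, hs']
    rw [map_add, map_mul, Complex.conj_ofReal, Complex.conj_ofReal, Complex.conj_I]
    push_cast
    ring
  have h1 : ‖riemannZeta s‖ * ‖Complex.Gammaℝ s‖ = ‖riemannZeta s'‖ * ‖Complex.Gammaℝ s'‖ := by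
    rw [← gs_completed s (by linarith), ← completedRiemannZeta_one_sub, e,
      gs_completed _ (by rw [Complex.conj_re]; linarith), riemannZeta_conj, Complex.norm_conj,
      gs_gammaR_conj]
  have h2 := gs_gammaR (1 / 2 - x) (1 / 2 + x) t (by linarith) (by linarith)
  rw [← hs, ← hs'] at h2
  have hG : 0 < ‖Complex.Gammaℝ s‖ :=
    norm_pos_iff.2 (Complex.Gammaℝ_ne_zero_of_re_pos (by linarith))
  rw [norm_mul, norm_mul]
  refine le_of_mul_le_mul_right ?_ hG
  have := mul_le_mul_of_nonneg_left h2 (norm_nonneg (riemannZeta s'))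
  calc _ = (‖riemannZeta s‖ * ‖Complex.Gammaℝ s‖) * ‖Complex.Gammaℝ ((1 / 2 + x : ℝ) : ℂ)‖ := by ring
    _ = ‖riemannZeta s'‖ *
        (‖Complex.Gammaℝ s'‖ * ‖Complex.Gammaℝ ((1 / 2 + x : ℝ) : ℂ)‖) := by rw [h1]; ring
    _ ≤ _ := this
    _ = _ := by ring

lemma gs_inner (t : ℝ) :
    inner ℝ (riemannZeta (1 / 2 + Complex.I * t) * Complex.Gammaℝ (1 / 2))
      (deriv riemannZeta (1 / 2 + Complex.I * t) * Complex.Gammaℝ (1 / 2) +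
        riemannZeta (1 / 2 + Complex.I * t) * deriv Complex.Gammaℝ (1 / 2)) ≤ 0 := by
  have hG0 : Complex.Gammaℝ (1 / 2) ≠ 0 := Complex.Gammaℝ_ne_zero_of_re_pos (by norm_num)
  have hG : HasDerivAt Complex.Gammaℝ (deriv Complex.Gammaℝ (1 / 2)) (1 / 2) := by
    apply DifferentiableAt.hasDerivAt
    have := (Complex.differentiable_Gammaℝ_inv (1 / 2)).inv (inv_ne_zero hG0)
    have e : (fun s => (Complex.Gammaℝ s)⁻¹)⁻¹ = Complex.Gammaℝ := by
      ext s; simp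
    rwa [e] at this
  have hne : (1 / 2 + Complex.I * t : ℂ) ≠ 1 := by
    intro h
    have := congrArg Complex.re h
    norm_num at this
  have hz := (differentiableAt_riemannZeta hne).hasDerivAt
  have hf := (hz.comp_add_const (1 / 2 : ℂ) (Complex.I * t)).mul hG
  have hg : HasDerivAt (fun x : ℝ => ((1 / 2 + x : ℝ) : ℂ)) 1 0 := by
    simpa using ((hasDerivAt_id (0 : ℝ)).const_add (1 / 2 : ℝ)).ofReal_comp
  have e0 : (((1 / 2 + 0 : ℝ)) : ℂ) = 1 / 2 := by push_cast; ring
  have hc := HasDerivAt.comp (0 : ℝ) (by rw [e0]; exact hf) hg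
  have hn := hc.norm_sq
  have := gs_deriv_aux _ _ hn (fun x hx hx' => by
    have h := gs_main t x hx hx'
    simp only [Function.comp, Pi.mul_apply]
    rw [← sub_eq_add_neg]
    exact pow_le_pow_left₀ (norm_nonneg _) h 2)
  simp only [Function.comp, Pi.mul_apply, e0, mul_one] at this
  linarith

/-- **Garunkštis–Steuding.** The set of pairs
`(ζ(1/2 + it), ζ'(1/2 + it))`, `t ∈ ℝ`, is not dense in `ℂ²`. -/
theorem garunkstis_steuding_not_dense :
    ¬ Dense {p : ℂ × ℂ | ∃ t : ℝ,
      p = (riemannZeta (1 / 2 + Complex.I * t),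
           deriv riemannZeta (1 / 2 + Complex.I * t))} := by
  intro hd
  have hG0 : Complex.Gammaℝ (1 / 2) ≠ 0 := Complex.Gammaℝ_ne_zero_of_re_pos (by norm_num)
  have ho : IsOpen {p : ℂ × ℂ | 0 < inner ℝ (p.1 * Complex.Gammaℝ (1 / 2))
      (p.2 * Complex.Gammaℝ (1 / 2) + p.1 * deriv Complex.Gammaℝ (1 / 2))} :=
    isOpen_lt continuous_const (by fun_prop)
  obtain ⟨p, ⟨t, rfl⟩, hp⟩ := hd.exists_mem_open ho
    ⟨(1, (Complex.Gammaℝ (1 / 2) - deriv Complex.Gammaℝ (1 / 2)) / Complex.Gammaℝ (1 / 2)), by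
      simp only [Set.mem_ofPred_eq]
      rw [div_mul_cancel₀ _ hG0, one_mul, one_mul, sub_add_cancel]
      exact real_inner_self_pos.2 hG0⟩
  exact absurd (gs_inner t) (not_le.2 hp)
end
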